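/- arXiv:2506.20779 — 5 statements merged into one kernel-verified Lean document; each statement's English description precedes it below -/
import Mathlib

section
/- Let σ > 0. There exist absolute constants c > 0 and c' > 0 such that whenever σ²/n ≤ c', the following univariate minimax lower bound holds: for every estimator f̂, i.e. every measurable map from datasets D_n ∈ ([−1,1] × ℝ)^n to L²([−1,1]), there exists a twice continuously differentiable function f : [−1,1] → ℝ with ‖f‖_{L∞([−1,1])} ≤ 1 and ∫_{−1}^1 |f''(x)| (1−|x|)³ dx ≤ 1 such that E‖f̂(D_n) − f‖²_{L²([−1,1])} ≥ c (σ²/n)^{1/2}, where the expectation is over D_n = ((x_1, f(x_1)+ε_1),…,(x_n, f(x_n)+ε_n)) with x_1,…,x_n i.i.d. uniform on [−1,1] and ε_1,…,ε_n i.i.d. N(0,σ²), independent of the x_i. -/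
open MeasureTheory Real Filter ProbabilityTheory
open scoped ENNReal Classical BigOperators

noncomputable section

abbrev Euc (d : ℕ) : Type := EuclideanSpace ℝ (Fin d)

def relu (t : ℝ) : ℝ := max t 0

abbrev ParamIx (d K : ℕ) : Type := (Fin K × Fin d) ⊕ (Fin K ⊕ (Fin K ⊕ Unit))

abbrev Params (d K : ℕ) : Type := EuclideanSpace ℝ (ParamIx d K)

/-- input-layer weight `w_k j` -/
def wP {d K : ℕ} (θ : Params d K) (k : Fin K) (j : Fin d) : ℝ := θ (Sum.inl (k, j))
/-- input-layer bias `b_k` -/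
def bP {d K : ℕ} (θ : Params d K) (k : Fin K) : ℝ := θ (Sum.inr (Sum.inl k))
/-- output-layer weight `v_k` -/
def vP {d K : ℕ} (θ : Params d K) (k : Fin K) : ℝ := θ (Sum.inr (Sum.inr (Sum.inl k)))
/-- output bias `β` -/
def betaP {d K : ℕ} (θ : Params d K) : ℝ := θ (Sum.inr (Sum.inr (Sum.inr ())))

/-- two-layer ReLU network `f_θ(x) = Σ_k v_k relu(w_kᵀ x − b_k) + β` -/
def netFun {d K : ℕ} (θ : Params d K) (x : Euc d) : ℝ :=
  (∑ k, vP θ k * relu ((∑ j, wP θ k j * x j) - bP θ k)) + betaP θ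

/-- empirical squared loss -/
def empLoss {d K : ℕ} (n : ℕ) (x : Fin n → Euc d) (y : Fin n → ℝ) (θ : Params d K) : ℝ :=
  (1 / (2 * (n : ℝ))) * ∑ i, (y i - netFun θ (x i)) ^ 2

/-- Hessian quadratic form `vᵀ ∇²L(θ) v` -/
def hessQF {E : Type*} [NormedAddCommGroup E] [NormedSpace ℝ E] (L : E → ℝ) (θ v : E) : ℝ :=
  iteratedFDeriv ℝ 2 L θ ![v, v]

/-- largest eigenvalue of the (symmetric) Hessian of `L` at `θ` -/
def lambdaMax {E : Type*} [NormedAddCommGroup E] [NormedSpace ℝ E] (L : E → ℝ) (θ : E) : ℝ :=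
  ⨆ v : {v : E // ‖v‖ = 1}, hessQF L θ v.1

/-- weighted variation seminorm -/
def VgSeminorm (d : ℕ) (R : ℝ) (g : Euc d × ℝ → ℝ) (f : Euc d → ℝ) : ℝ≥0∞ :=
  sInf { m : ℝ≥0∞ |
    ∃ (ν : MeasureTheory.SignedMeasure (Euc d × ℝ)) (c : Euc d) (c₀ : ℝ),
      ν.totalVariation ((Metric.sphere (0 : Euc d) 1 ×ˢ Set.Icc (-R) R)ᶜ) = 0 ∧
      (∀ x ∈ Metric.closedBall (0 : Euc d) R,
        f x = (∫ p : Euc d × ℝ, relu ((∑ j, p.1 j * x j) - p.2)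
                  ∂ν.toJordanDecomposition.posPart)
              - (∫ p : Euc d × ℝ, relu ((∑ j, p.1 j * x j) - p.2)
                  ∂ν.toJordanDecomposition.negPart)
              + (∑ j, c j * x j) + c₀) ∧
      m = ∫⁻ p, ENNReal.ofReal (g p) ∂ν.totalVariation }

def gTilde {d : ℕ} (n : ℕ) (x : Fin n → Euc d) (u : Euc d) (t : ℝ) : ℝ :=
  (((Finset.univ.filter fun i => t < ∑ j, u j * x i j).card : ℝ) / (n : ℝ)) ^ 2 *
    ((∑ i ∈ Finset.univ.filter fun i => t < ∑ j, u j * x i j, ((∑ j, u j * x i j) - t)) /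
      ((Finset.univ.filter fun i => t < ∑ j, u j * x i j).card : ℝ)) *
    Real.sqrt (1 + ‖(((Finset.univ.filter fun i => t < ∑ j, u j * x i j).card : ℝ))⁻¹ •
      ∑ i ∈ Finset.univ.filter fun i => t < ∑ j, u j * x i j, x i‖ ^ 2)

def gData {d : ℕ} (n : ℕ) (x : Fin n → Euc d) : Euc d × ℝ → ℝ :=
  fun p => min (gTilde n x p.1 p.2) (gTilde n x (-p.1) (-p.2))

def gPow (d : ℕ) : Euc d × ℝ → ℝ :=
  fun p => if |p.2| ≤ 1 then (1 - |p.2|) ^ (d + 2) else 0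

def uniformBall (d : ℕ) : Measure (Euc d) :=
  (volume (Metric.closedBall (0 : Euc d) 1))⁻¹ • volume.restrict (Metric.closedBall 0 1)

instance (d : ℕ) : IsProbabilityMeasure (uniformBall d) := by
  constructor
  rw [uniformBall, Measure.smul_apply, Measure.restrict_apply MeasurableSet.univ,
    Set.univ_inter, smul_eq_mul, ENNReal.inv_mul_cancel]
  · exact (Metric.measure_closedBall_pos volume (0 : Euc d) one_pos).ne'
  · exact (isCompact_closedBall _ _).measure_lt_top.ne

/-- set of stable solutions for the dataset `(x, y)` -/
def FStable (d : ℕ) (η : ℝ) {n : ℕ} (x : Fin n → Euc d) (y : Fin n → ℝ) (f : Euc d → ℝ) : Prop :=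
  ∃ (K : ℕ) (θ : Params d K),
    (∀ z, f z = netFun θ z) ∧
    ContDiffAt ℝ 2 (empLoss n x y) θ ∧
    lambdaMax (empLoss n x y) θ ≤ 2 / η

/-- membership in the (unweighted) variation ball `V_C(B_1^d)` -/
def memVC (d : ℕ) (C : ℝ) (f : Euc d → ℝ) : Prop :=
  ∃ (ν : MeasureTheory.SignedMeasure (Euc d × ℝ)) (c : Euc d) (b : ℝ),
    ν.totalVariation ((Metric.sphere (0 : Euc d) 1 ×ˢ Set.Icc (-1 : ℝ) 1)ᶜ) = 0 ∧
    ν.totalVariation Set.univ ≤ ENNReal.ofReal C ∧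
    ∀ x ∈ Metric.closedBall (0 : Euc d) 1,
      f x = (∫ p : Euc d × ℝ, relu ((∑ j, p.1 j * x j) - p.2)
                ∂ν.toJordanDecomposition.posPart)
            - (∫ p : Euc d × ℝ, relu ((∑ j, p.1 j * x j) - p.2)
                ∂ν.toJordanDecomposition.negPart)
            + (∑ j, c j * x j) + b


def uniformIcc : MeasureTheory.Measure ℝ :=
  (MeasureTheory.volume (Set.Icc (-1 : ℝ) 1))⁻¹ •
    MeasureTheory.volume.restrict (Set.Icc (-1 : ℝ) 1)

lemma aux_pi_density {n : ℕ} (u : Fin n → ℝ) {v : NNReal} (hv : v ≠ 0) :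
    Measure.pi (fun i => gaussianReal (u i) v) =
      (volume : Measure (Fin n → ℝ)).withDensity (fun y => ∏ i, gaussianPDF (u i) v (y i)) := by
  apply Measure.pi_eq
  intro s hs
  rw [withDensity_apply _ (MeasurableSet.univ_pi hs), volume_pi, Measure.restrict_pi_pi]
  have h1 : ∀ i, Integrable (gaussianPDFReal (u i) v) (volume.restrict (s i)) :=
    fun i => (integrable_gaussianPDFReal _ _).restrict
  have h2 : ∀ y : Fin n → ℝ, ∏ i, gaussianPDF (u i) v (y i)
      = ENNReal.ofReal (∏ i, gaussianPDFReal (u i) v (y i)) := by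
    intro y
    rw [ENNReal.ofReal_prod_of_nonneg (fun i _ => gaussianPDFReal_nonneg _ _ _)]
    rfl
  simp_rw [h2]
  rw [← ofReal_integral_eq_lintegral_ofReal (Integrable.fintype_prod h1)
    (Eventually.of_forall fun y => Finset.prod_nonneg fun i _ => gaussianPDFReal_nonneg _ _ _),
    integral_fintype_prod_eq_prod,
    ENNReal.ofReal_prod_of_nonneg
      (fun i _ => integral_nonneg fun y => gaussianPDFReal_nonneg _ _ _)]
  refine Finset.prod_congr rfl fun i _ => ?_
  rw [ofReal_integral_eq_lintegral_ofReal (h1 i)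
    (Eventually.of_forall fun y => gaussianPDFReal_nonneg _ _ _),
    gaussianReal_of_var_ne_zero _ hv, withDensity_apply _ (hs i)]
  rfl

lemma aux_shift {n : ℕ} (u : Fin n → ℝ) (v : NNReal) (G : (Fin n → ℝ) → ℝ≥0∞)
    (hG : Measurable G) :
    ∫⁻ z, G (fun i => u i + z i) ∂(Measure.pi fun _ : Fin n => gaussianReal 0 v)
      = ∫⁻ y, G y ∂(Measure.pi fun i : Fin n => gaussianReal (u i) v) := by
  have h : Measure.map (fun (z : Fin n → ℝ) i => u i + z i)
      (Measure.pi fun _ : Fin n => gaussianReal 0 v)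
      = Measure.pi fun i : Fin n => gaussianReal (u i) v := by
    have := Measure.pi_map_pi (μ := fun _ : Fin n => gaussianReal 0 v)
      (f := fun i x => u i + x)
      (hμ := fun i => by rw [gaussianReal_map_const_add]; infer_instance)
      (fun i => by fun_prop)
    rw [this]
    simp [gaussianReal_map_const_add]
  rw [← h, lintegral_map hG (by fun_prop)]

lemma aux_var {n : ℕ} (u a : Fin n → ℝ) (v : NNReal) :
    ∫⁻ y, ENNReal.ofReal ((∑ i, a i * (y i - u i)) ^ 2)
      ∂(Measure.pi fun i : Fin n => gaussianReal (u i) v)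
      = ENNReal.ofReal (∑ i, a i ^ 2 * v) := by
  set P := Measure.pi fun i : Fin n => gaussianReal (u i) v
  have hm : ∀ i, MemLp (fun x : ℝ => a i * (x - u i)) 2 (gaussianReal (u i) v) := by
    intro i
    have := (memLp_id_gaussianReal (μ := u i) (v := v) 2)
    exact (this.sub (memLp_const (u i))).const_mul (a i)
  have hmP : ∀ i, MemLp (fun y : Fin n → ℝ => a i * (y i - u i)) 2 P := fun i =>
    (hm i).comp_measurePreserving (measurePreserving_eval _ i)
  have hint : ∀ i, ∫ y, a i * (y i - u i) ∂P = 0 := by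
    intro i
    rw [integral_comp_eval (μ := fun i : Fin n => gaussianReal (u i) v)
      (f := fun x => a i * (x - u i)) (by fun_prop), integral_const_mul, integral_sub]
    · simp
    · exact (memLp_id_gaussianReal (μ := u i) (v := v) 1).integrable (by simp)
    · simp
  have hmean : ∫ y, (∑ i, a i * (y i - u i)) ∂P = 0 := by
    rw [integral_finsetSum _ (fun i _ => (hmP i).integrable (by simp))]
    simp [hint]
  have hS : MemLp (fun y : Fin n → ℝ => ∑ i, a i * (y i - u i)) 2 P :=
    memLp_finsetSum _ fun i _ => hmP i
  have h1 := evariance_eq_lintegral_ofReal (fun y : Fin n → ℝ => ∑ i, a i * (y i - u i)) P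
  rw [hmean] at h1
  simp only [sub_zero] at h1
  rw [← h1, ← ofReal_variance hS]
  have h2 := variance_sum_pi hm
  have h3 : (∑ i, fun ω : Fin n → ℝ => a i * (ω i - u i)) = fun y => ∑ i, a i * (y i - u i) := by
    ext y; simp
  rw [h3] at h2
  rw [h2]
  congr 1
  refine Finset.sum_congr rfl fun i _ => ?_
  rw [variance_const_mul, variance_sub_const (by fun_prop)]
  congr 1
  exact variance_id_gaussianReal

lemma aux_real_ineq (x s : ℝ) :
    3 / 4 ≤ min 1 (rexp (x - s / 2)) + (s / 2 + x ^ 2) ∨ s < 0 := by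
  by_cases hs : s < 0
  · exact Or.inr hs
  left
  push Not at hs
  rcases le_total 1 (rexp (x - s / 2)) with h | h
  · rw [min_eq_left h]; nlinarith [sq_nonneg x]
  · rw [min_eq_right h]
    have := Real.add_one_le_exp (x - s / 2)
    nlinarith [sq_nonneg (x + 1 / 2)]

lemma aux_lecam {n : ℕ} (u u' : Fin n → ℝ) {v : NNReal} (hv : v ≠ 0)
    (G G' : (Fin n → ℝ) → ℝ≥0∞) (hG : Measurable G) (hG' : Measurable G') (r : ℝ≥0∞)
    (hr : ∀ y, r ≤ G y + G' y) :
    r * ENNReal.ofReal (3 / 4) ≤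
      ∫⁻ z, G (fun i => u i + z i) ∂(Measure.pi fun _ : Fin n => gaussianReal 0 v)
      + ∫⁻ z, G' (fun i => u' i + z i) ∂(Measure.pi fun _ : Fin n => gaussianReal 0 v)
      + r * ENNReal.ofReal (3 / 2 * ∑ i, (u' i - u i) ^ 2 / v) := by
  rw [aux_shift u v G hG, aux_shift u' v G' hG']
  set s : ℝ := ∑ i, (u' i - u i) ^ 2 / v with hs
  have hv0 : (0 : ℝ) < v := by positivity
  have hs0 : 0 ≤ s := Finset.sum_nonneg fun i _ => by positivity
  set p : (Fin n → ℝ) → ℝ≥0∞ := fun y => ∏ i, gaussianPDF (u i) v (y i) with hp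
  set q : (Fin n → ℝ) → ℝ≥0∞ := fun y => ∏ i, gaussianPDF (u' i) v (y i) with hq
  have hpm : Measurable p := Finset.measurable_prod _ fun i _ =>
    (measurable_gaussianPDF _ _).comp (measurable_pi_apply i)
  have hqm : Measurable q := Finset.measurable_prod _ fun i _ =>
    (measurable_gaussianPDF _ _).comp (measurable_pi_apply i)
  set a : Fin n → ℝ := fun i => (u' i - u i) / v with ha
  set W : (Fin n → ℝ) → ℝ := fun y => ∑ i, a i * (y i - u i) with hW
  have hWm : Measurable W := by fun_prop
  have hqp : ∀ y, q y = p y * ENNReal.ofReal (rexp (W y - s / 2)) := by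
    intro y
    have e : W y - s / 2 = ∑ i, (a i * (y i - u i) - (u' i - u i) ^ 2 / v / 2) := by
      rw [Finset.sum_sub_distrib, ← Finset.sum_div]
    rw [e, Real.exp_sum, ENNReal.ofReal_prod_of_nonneg (fun i _ => (Real.exp_pos _).le)]
    simp only [hp, hq]
    rw [← Finset.prod_mul_distrib]
    refine Finset.prod_congr rfl fun i _ => ?_
    simp only [gaussianPDF]
    rw [← ENNReal.ofReal_mul (gaussianPDFReal_nonneg _ _ _)]
    congr 1
    simp only [gaussianPDFReal_def]
    rw [mul_assoc _ (rexp _) (rexp _), ← Real.exp_add]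
    congr 2
    simp only [ha]
    field_simp
    ring
  have hpt : ∀ y, p y * ENNReal.ofReal (3 / 4) ≤
      min (p y) (q y) + p y * ENNReal.ofReal (s / 2 + W y ^ 2) := by
    intro y
    have h1 : min (p y) (q y) = p y * ENNReal.ofReal (min 1 (rexp (W y - s / 2))) := by
      rw [hqp, ENNReal.ofReal_min, ENNReal.ofReal_one, mul_min, mul_one]
    rw [h1, ← mul_add, ← ENNReal.ofReal_add (by positivity) (by positivity)]
    gcongr
    rcases aux_real_ineq (W y) s with h | h
    · exact h
    · linarith
  have hPp : ∀ (H : (Fin n → ℝ) → ℝ≥0∞), Measurable H →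
      ∫⁻ y, H y ∂(Measure.pi fun i : Fin n => gaussianReal (u i) v) = ∫⁻ y, p y * H y := by
    intro H hH
    rw [aux_pi_density u hv, lintegral_withDensity_eq_lintegral_mul _ hpm hH]
    rfl
  have hQq : ∀ (H : (Fin n → ℝ) → ℝ≥0∞), Measurable H →
      ∫⁻ y, H y ∂(Measure.pi fun i : Fin n => gaussianReal (u' i) v) = ∫⁻ y, q y * H y := by
    intro H hH
    rw [aux_pi_density u' hv, lintegral_withDensity_eq_lintegral_mul _ hqm hH]
    rfl
  have hone : ENNReal.ofReal (3 / 4) = ∫⁻ y, p y * ENNReal.ofReal (3 / 4) := by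
    rw [← hPp _ measurable_const]; simp
  have hvar : ∫⁻ y, p y * ENNReal.ofReal (s / 2 + W y ^ 2) = ENNReal.ofReal (3 / 2 * s) := by
    rw [← hPp _ (by fun_prop)]
    have : ∀ y, ENNReal.ofReal (s / 2 + W y ^ 2)
        = ENNReal.ofReal (s / 2) + ENNReal.ofReal (W y ^ 2) := fun y =>
      ENNReal.ofReal_add (by positivity) (by positivity)
    simp_rw [this]
    rw [lintegral_add_left measurable_const, aux_var u a v]
    have h5 : ∑ i, a i ^ 2 * (v : ℝ) = s := by
      rw [hs]
      refine Finset.sum_congr rfl fun i _ => ?_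
      simp only [ha]
      field_simp
    rw [h5, lintegral_const, measure_univ, mul_one, ← ENNReal.ofReal_add (by positivity) hs0]
    congr 1; ring
  have hmin : ENNReal.ofReal (3 / 4) ≤ (∫⁻ y, min (p y) (q y)) + ENNReal.ofReal (3 / 2 * s) := by
    rw [← hvar]
    calc ENNReal.ofReal (3 / 4) = ∫⁻ y, p y * ENNReal.ofReal (3 / 4) := hone
      _ ≤ ∫⁻ y, (min (p y) (q y) + p y * ENNReal.ofReal (s / 2 + W y ^ 2)) :=
        lintegral_mono hpt
      _ = _ := lintegral_add_left (hpm.min hqm) _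
  calc r * ENNReal.ofReal (3 / 4)
      ≤ r * ((∫⁻ y, min (p y) (q y)) + ENNReal.ofReal (3 / 2 * s)) := by gcongr
    _ = (∫⁻ y, r * min (p y) (q y)) + r * ENNReal.ofReal (3 / 2 * s) := by
        rw [mul_add, lintegral_const_mul _ (hpm.min hqm)]
    _ ≤ (∫⁻ y, (p y * G y + q y * G' y)) + r * ENNReal.ofReal (3 / 2 * s) := by
        refine add_le_add_left (lintegral_mono fun y => ?_) _
        calc r * min (p y) (q y) ≤ (G y + G' y) * min (p y) (q y) := by gcongr; exact hr y
          _ = min (p y) (q y) * G y + min (p y) (q y) * G' y := by ring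
          _ ≤ _ := by gcongr; exacts [min_le_left _ _, min_le_right _ _]
    _ = _ := by
        rw [lintegral_add_left (by fun_prop), hPp _ hG, hQq _ hG']


lemma aux_uniform_prob : IsProbabilityMeasure uniformIcc := by
  constructor
  rw [uniformIcc, Measure.smul_apply, Measure.restrict_apply MeasurableSet.univ,
    Set.univ_inter, smul_eq_mul, ENNReal.inv_mul_cancel]
  · simp
  · simp

def auxRisk {n : ℕ} (σ : ℝ) (fhat : (Fin n → ℝ × ℝ) → ℝ → ℝ) (J : Set ℝ) (f : ℝ → ℝ) : ℝ≥0∞ :=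
  ∫⁻ ω : (Fin n → ℝ) × (Fin n → ℝ),
    ∫⁻ t in J, ENNReal.ofReal ((fhat (fun i => (ω.1 i, f (ω.1 i) + ω.2 i)) t - f t) ^ 2) ∂volume
    ∂((Measure.pi fun _ : Fin n => uniformIcc).prod
      (Measure.pi fun _ : Fin n => gaussianReal 0 (σ ^ 2).toNNReal))

lemma aux_meas_loss {n : ℕ} (fhat : (Fin n → ℝ × ℝ) → ℝ → ℝ)
    (hm : Measurable (fun p : (Fin n → ℝ × ℝ) × ℝ => fhat p.1 p.2)) (J : Set ℝ) (f : ℝ → ℝ)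
    (hf : Measurable f) :
    Measurable (fun D : Fin n → ℝ × ℝ => ∫⁻ t in J, ENNReal.ofReal ((fhat D t - f t) ^ 2)) := by
  apply Measurable.lintegral_prod_right'
    (f := fun p : (Fin n → ℝ × ℝ) × ℝ => ENNReal.ofReal ((fhat p.1 p.2 - f p.2) ^ 2))
  exact ((hm.sub (hf.comp measurable_snd)).pow_const 2).ennreal_ofReal

lemma aux_risk_iter {n : ℕ} (σ : ℝ) (fhat : (Fin n → ℝ × ℝ) → ℝ → ℝ)
    (hm : Measurable (fun p : (Fin n → ℝ × ℝ) × ℝ => fhat p.1 p.2)) (J : Set ℝ) (f : ℝ → ℝ)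
    (hf : Measurable f) :
    auxRisk σ fhat J f = ∫⁻ x, ∫⁻ z, (∫⁻ t in J, ENNReal.ofReal
        ((fhat (fun i => (x i, f (x i) + z i)) t - f t) ^ 2))
        ∂(Measure.pi fun _ : Fin n => gaussianReal 0 (σ ^ 2).toNNReal)
        ∂(Measure.pi fun _ : Fin n => uniformIcc) := by
  have := aux_uniform_prob
  rw [auxRisk, lintegral_prod]
  apply Measurable.aemeasurable
  exact (aux_meas_loss fhat hm J f hf).comp
    (g := fun D : Fin n → ℝ × ℝ => ∫⁻ t in J, ENNReal.ofReal ((fhat D t - f t) ^ 2))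
    (f := fun ω : (Fin n → ℝ) × (Fin n → ℝ) => fun i => (ω.1 i, f (ω.1 i) + ω.2 i))
    (by
      rw [measurable_pi_iff]
      intro i
      have h1 : Measurable (fun ω : (Fin n → ℝ) × (Fin n → ℝ) => ω.1 i) := by fun_prop
      have h2 : Measurable (fun ω : (Fin n → ℝ) × (Fin n → ℝ) => ω.2 i) := by fun_prop
      exact h1.prodMk ((hf.comp h1).add h2))

lemma aux_pair {n : ℕ} (hn : 0 < n) (σ : ℝ) (hσ : 0 < σ) (fhat : (Fin n → ℝ × ℝ) → ℝ → ℝ)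
    (hm : Measurable (fun p : (Fin n → ℝ × ℝ) × ℝ => fhat p.1 p.2)) (J : Set ℝ)
    (hJ : MeasurableSet J) (hJv : volume J ≠ ∞) (f f' : ℝ → ℝ)
    (hf : Measurable f) (hf' : Measurable f') (hff : ∀ t ∈ J, 1 ≤ (f t - f' t) ^ 2)
    (w : ℝ)
    (hS : ∫⁻ t in Set.Icc (-1 : ℝ) 1, ENNReal.ofReal ((f' t - f t) ^ 2) ≤ ENNReal.ofReal w)
    (hnw : n * w / σ ^ 2 ≤ 1 / 4) :
    ENNReal.ofReal (9 / 32) * volume J ≤ auxRisk σ fhat J f + auxRisk σ fhat J f' := by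
  have hprob := aux_uniform_prob
  set v := (σ ^ 2).toNNReal with hv
  have hvr : (v : ℝ) = σ ^ 2 := Real.coe_toNNReal _ (by positivity)
  have hv0 : v ≠ 0 := by
    intro h; rw [h] at hvr; have := pow_pos hσ 2; simp at hvr; linarith
  set r : ℝ≥0∞ := ENNReal.ofReal (1 / 2) * volume J with hr
  have hrtop : r ≠ ∞ := ENNReal.mul_ne_top (by simp) hJv
  set L : (ℝ → ℝ) → (Fin n → ℝ × ℝ) → ℝ≥0∞ := fun g D =>
    ∫⁻ t in J, ENNReal.ofReal ((fhat D t - g t) ^ 2) with hL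
  have hLm : ∀ g, Measurable g → Measurable (L g) := fun g hg => aux_meas_loss fhat hm J g hg
  have hsum : ∀ D, r ≤ L f D + L f' D := by
    intro D
    have hD : Measurable (fhat D) := hm.comp (measurable_const.prodMk measurable_id)
    simp only [hL]
    rw [← lintegral_add_left (by fun_prop), hr, ← setLIntegral_const]
    apply setLIntegral_mono' hJ
    intro t ht
    rw [← ENNReal.ofReal_add (by positivity) (by positivity)]
    apply ENNReal.ofReal_le_ofReal
    nlinarith [hff t ht, sq_nonneg ((fhat D t - f t) + (fhat D t - f' t))]
  set A : (ℝ → ℝ) → (Fin n → ℝ) → ℝ≥0∞ := fun g x =>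
    ∫⁻ z, L g (fun i => (x i, g (x i) + z i)) ∂(Measure.pi fun _ : Fin n => gaussianReal 0 v)
    with hA
  have hpt : ∀ x : Fin n → ℝ, r * ENNReal.ofReal (3 / 4) ≤ A f x + A f' x +
      r * ENNReal.ofReal (3 / 2 * ∑ i, (f' (x i) - f (x i)) ^ 2 / σ ^ 2) := by
    intro x
    rw [← hvr]
    have hmx : Measurable (fun y : Fin n → ℝ => fun i => (x i, y i)) := by fun_prop
    exact aux_lecam (fun i => f (x i)) (fun i => f' (x i)) hv0
      (fun y => L f (fun i => (x i, y i))) (fun y => L f' (fun i => (x i, y i)))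
      ((hLm f hf).comp hmx) ((hLm f' hf').comp hmx) r (fun y => hsum _)
  have hAm : ∀ g, Measurable g → Measurable (A g) := by
    intro g hg
    apply Measurable.lintegral_prod_right'
      (f := fun p : (Fin n → ℝ) × (Fin n → ℝ) => L g (fun i => (p.1 i, g (p.1 i) + p.2 i)))
    refine (hLm g hg).comp ?_
    rw [measurable_pi_iff]
    intro i
    have h1 : Measurable (fun ω : (Fin n → ℝ) × (Fin n → ℝ) => ω.1 i) := by fun_prop
    have h2 : Measurable (fun ω : (Fin n → ℝ) × (Fin n → ℝ) => ω.2 i) := by fun_prop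
    exact h1.prodMk ((hg.comp h1).add h2)
  have hδ : ∫⁻ t, ENNReal.ofReal ((f' t - f t) ^ 2) ∂uniformIcc ≤ ENNReal.ofReal (w / 2) := by
    rw [uniformIcc, lintegral_smul_measure, smul_eq_mul, Real.volume_Icc,
      show w / 2 = (1 - (-1 : ℝ))⁻¹ * w by ring, ENNReal.ofReal_mul (by norm_num),
      ENNReal.ofReal_inv_of_pos (by norm_num)]
    gcongr
  have hSx : ∫⁻ x, ENNReal.ofReal (3 / 2 * ∑ i, (f' (x i) - f (x i)) ^ 2 / σ ^ 2)
      ∂(Measure.pi fun _ : Fin n => uniformIcc) ≤ ENNReal.ofReal (3 / 16) := by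
    have e : ∀ x : Fin n → ℝ, ENNReal.ofReal (3 / 2 * ∑ i, (f' (x i) - f (x i)) ^ 2 / σ ^ 2)
        = ∑ i, ENNReal.ofReal (3 / 2 / σ ^ 2) * ENNReal.ofReal ((f' (x i) - f (x i)) ^ 2) := by
      intro x
      rw [Finset.mul_sum, ENNReal.ofReal_sum_of_nonneg (fun i _ => by positivity)]
      refine Finset.sum_congr rfl fun i _ => ?_
      rw [← ENNReal.ofReal_mul (by positivity)]
      congr 1; ring
    simp_rw [e]
    have hdm : Measurable (fun t => ENNReal.ofReal ((f' t - f t) ^ 2)) := by fun_prop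
    rw [lintegral_finsetSum _ (fun i _ => by fun_prop)]
    have e2 : ∀ i : Fin n, ∫⁻ x : Fin n → ℝ, ENNReal.ofReal (3 / 2 / σ ^ 2) *
        ENNReal.ofReal ((f' (x i) - f (x i)) ^ 2) ∂(Measure.pi fun _ : Fin n => uniformIcc)
        ≤ ENNReal.ofReal (3 / 2 / σ ^ 2) * ENNReal.ofReal (w / 2) := by
      intro i
      rw [lintegral_const_mul _ (by fun_prop)]
      gcongr
      have := (measurePreserving_eval (fun _ : Fin n => uniformIcc) i).lintegral_comp hdm
      simp only [Function.eval] at this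
      rw [this]
      exact hδ
    refine (Finset.sum_le_sum fun i _ => e2 i).trans ?_
    rw [Finset.sum_const, Finset.card_univ, Fintype.card_fin, nsmul_eq_mul,
      ← ENNReal.ofReal_mul (by positivity), ← ENNReal.ofReal_natCast,
      ← ENNReal.ofReal_mul (by positivity)]
    apply ENNReal.ofReal_le_ofReal
    calc (n : ℝ) * (3 / 2 / σ ^ 2 * (w / 2)) = 3 / 4 * (n * w / σ ^ 2) := by ring
      _ ≤ 3 / 4 * (1 / 4) := by gcongr
      _ = 3 / 16 := by norm_num
  have hfin : r * ENNReal.ofReal (3 / 4) ≤ auxRisk σ fhat J f + auxRisk σ fhat J f'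
      + r * ENNReal.ofReal (3 / 16) := by
    rw [aux_risk_iter σ fhat hm J f hf, aux_risk_iter σ fhat hm J f' hf']
    have h1 : ∫⁻ x : Fin n → ℝ, r * ENNReal.ofReal (3 / 4)
        ∂(Measure.pi fun _ : Fin n => uniformIcc) = r * ENNReal.ofReal (3 / 4) := by simp
    rw [← h1]
    refine (lintegral_mono hpt).trans ?_
    have hA1 := hAm f hf
    have hA2 := hAm f' hf'
    rw [lintegral_add_left (by fun_prop), lintegral_add_left (hAm f hf),
      lintegral_const_mul _ (by fun_prop)]
    exact add_le_add le_rfl (mul_le_mul_right hSx r)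
  have h34 : r * ENNReal.ofReal (3 / 4) = ENNReal.ofReal (9 / 32) * volume J
      + r * ENNReal.ofReal (3 / 16) := by
    rw [hr, show (3 / 4 : ℝ) = 9 / 16 + 3 / 16 by norm_num,
      ENNReal.ofReal_add (by norm_num) (by norm_num), mul_add]
    congr 1
    rw [mul_right_comm, ← ENNReal.ofReal_mul (by norm_num)]
    norm_num
  rw [h34] at hfin
  exact (ENNReal.add_le_add_iff_right (ENNReal.mul_ne_top hrtop (by simp))).1 hfin

lemma aux_assouad {K : ℕ} (R : (Fin K → Bool) → ℝ≥0∞) (Rj : Fin K → (Fin K → Bool) → ℝ≥0∞)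
    (ρ : ℝ≥0∞) (h1 : ∀ e, ∑ j, Rj j e ≤ R e)
    (h2 : ∀ j e, ρ ≤ Rj j e + Rj j (Function.update e j (!e j))) :
    ∃ e, K * ρ ≤ 2 * R e := by
  by_contra! hcon
  have hlt : ∑ e, 2 * R e < ∑ _e : Fin K → Bool, K * ρ :=
    ENNReal.sum_lt_sum_of_nonempty Finset.univ_nonempty fun e _ => hcon e
  have hle : ∑ _e : Fin K → Bool, K * ρ ≤ ∑ e, 2 * R e := by
    have hflip : ∀ j : Fin K, ∑ e : Fin K → Bool, Rj j (Function.update e j (!e j))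
        = ∑ e, Rj j e := by
      intro j
      have hinv : Function.Involutive
          (fun e : Fin K → Bool => Function.update e j (!e j)) := by
        intro e
        simp
      exact Equiv.sum_comp hinv.toPerm (fun e => Rj j e)
    calc ∑ _e : Fin K → Bool, K * ρ = ∑ _e : Fin K → Bool, ∑ _j : Fin K, ρ := by simp
      _ = ∑ _j : Fin K, ∑ _e : Fin K → Bool, ρ := Finset.sum_comm
      _ ≤ ∑ j : Fin K, ∑ e : Fin K → Bool, (Rj j e + Rj j (Function.update e j (!e j))) :=
        Finset.sum_le_sum fun j _ => Finset.sum_le_sum fun e _ => h2 j e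
      _ = ∑ j : Fin K, ∑ e : Fin K → Bool, 2 * Rj j e := by
        refine Finset.sum_congr rfl fun j _ => ?_
        rw [Finset.sum_add_distrib, hflip, ← two_mul, Finset.mul_sum]
      _ = ∑ e : Fin K → Bool, 2 * ∑ j : Fin K, Rj j e := by
        rw [Finset.sum_comm]
        simp_rw [Finset.mul_sum]
      _ ≤ _ := Finset.sum_le_sum fun e _ => mul_le_mul_right (h1 e) 2
  exact absurd hlt (not_lt.2 hle)


lemma aux_bump : ∃ (ψ : ℝ → ℝ) (m : ℝ), 1 ≤ m ∧ ContDiff ℝ 2 ψ ∧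
    (∀ s, |ψ s| ≤ 1) ∧ (∀ s, (s ≤ 0 ∨ 1 ≤ s) → ψ s = 0) ∧
    (∀ s, 1 / 4 ≤ s → s ≤ 3 / 4 → ψ s = 1) ∧
    (∀ s, |deriv (deriv ψ) s| ≤ m ^ 2) ∧
    (∀ s, (s ≤ 0 ∨ 1 ≤ s) → deriv (deriv ψ) s = 0) := by
  let B : ContDiffBump (1 / 2 : ℝ) := ⟨1 / 4, 3 / 8, by norm_num, by norm_num⟩
  have hts : tsupport B = Metric.closedBall (1 / 2 : ℝ) (3 / 8) := B.tsupport_eq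
  have hout : ∀ s : ℝ, (s ≤ 0 ∨ 1 ≤ s) → s ∉ tsupport B := by
    intro s hs
    rw [hts, Real.closedBall_eq_Icc]
    rintro ⟨h1, h2⟩
    rcases hs with h | h <;> linarith
  have hc2 : ContDiff ℝ 2 (B : ℝ → ℝ) := B.contDiff
  have hc1 : ContDiff ℝ 1 (deriv (B : ℝ → ℝ)) := hc2.deriv' 
  have hc0 : Continuous (deriv (deriv (B : ℝ → ℝ))) := hc1.continuous_deriv le_rfl
  have hcs : HasCompactSupport (deriv (deriv (B : ℝ → ℝ))) := B.hasCompactSupport.deriv.deriv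
  obtain ⟨C, hC⟩ := hcs.exists_bound_of_continuous hc0
  have hC' : ∀ s, |deriv (deriv (B : ℝ → ℝ)) s| ≤ C := hC
  refine ⟨B, max 1 C, le_max_left _ _, hc2, ?_, ?_, ?_, ?_, ?_⟩
  · intro s
    rw [abs_of_nonneg B.nonneg]
    exact B.le_one
  · intro s hs
    exact image_eq_zero_of_notMem_tsupport (hout s hs)
  · intro s h1 h2
    apply B.one_of_mem_closedBall
    rw [Real.closedBall_eq_Icc]
    constructor
    · show (1 / 2 - 1 / 4 : ℝ) ≤ s
      linarith
    · show s ≤ (1 / 2 + 1 / 4 : ℝ)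
      linarith
  · intro s
    have h1 := le_max_left 1 C
    have h2 := le_max_right 1 C
    have := hC' s
    nlinarith
  · intro s hs
    by_contra hne
    have h1 : s ∈ tsupport (deriv (B : ℝ → ℝ)) := support_deriv_subset hne
    exact hout s hs (tsupport_deriv_subset h1)

lemma aux_disjoint {K : ℕ} (g : ℝ → ℝ) (M : ℝ) (hM : ∀ s, |g s| ≤ M)
    (hg : ∀ s, (s ≤ 0 ∨ 1 ≤ s) → g s = 0) (e : Fin K → ℝ) (he : ∀ j, |e j| ≤ 1) (s : ℝ) :
    |∑ j, e j * g (s - (j : ℕ))| ≤ M := by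
  have hM0 : 0 ≤ M := (abs_nonneg _).trans (hM 0)
  by_cases h : ∃ j : Fin K, 0 < s - (j : ℕ) ∧ s - (j : ℕ) < 1
  · obtain ⟨j, hj1, hj2⟩ := h
    rw [Finset.sum_eq_single j]
    · rw [abs_mul]
      calc |e j| * |g (s - (j : ℕ))| ≤ 1 * M :=
            mul_le_mul (he j) (hM _) (abs_nonneg _) zero_le_one
        _ = M := one_mul M
    · intro i _ hij
      rw [hg, mul_zero]
      rcases lt_or_gt_of_ne (fun h : (i : ℕ) = j => hij (Fin.ext h)) with h | h
      · right
        have : ((i : ℕ) : ℝ) + 1 ≤ (j : ℕ) := by exact_mod_cast h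
        linarith
      · left
        have : ((j : ℕ) : ℝ) + 1 ≤ (i : ℕ) := by exact_mod_cast h
        linarith
    · simp
  · push Not at h
    rw [Finset.sum_eq_zero]
    · simpa using hM0
    · intro j _
      rw [hg, mul_zero]
      by_contra! hc
      linarith [h j hc.1]

def auxF {K : ℕ} (ψ : ℝ → ℝ) (b w : ℝ) (e : Fin K → Bool) (t : ℝ) : ℝ :=
  ∑ j, (if e j then (1 : ℝ) else 0) * ψ ((t - b) / w - (j : ℕ))

lemma aux_e {K : ℕ} (e : Fin K → Bool) (j : Fin K) : |(if e j then (1 : ℝ) else 0)| ≤ 1 := by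
  split_ifs <;> simp

lemma aux_deriv_sum {K : ℕ} (g : ℝ → ℝ) (hg : Differentiable ℝ g) (b w : ℝ) (e : Fin K → ℝ)
    (t : ℝ) : deriv (fun t => ∑ j, e j * g ((t - b) / w - (j : ℕ))) t =
      ∑ j, (e j / w) * deriv g ((t - b) / w - (j : ℕ)) := by
  apply HasDerivAt.deriv
  apply HasDerivAt.fun_sum
  intro j _
  have h1 : HasDerivAt (fun t : ℝ => (t - b) / w - (j : ℕ)) (1 / w) t :=
    (((hasDerivAt_id t).sub_const b).div_const w).sub_const _
  have h2 := ((hg ((t - b) / w - (j : ℕ))).hasDerivAt.comp t h1).const_mul (e j)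
  exact h2.congr_deriv (by ring)

lemma auxF_deriv2 {K : ℕ} (ψ : ℝ → ℝ) (hψ : ContDiff ℝ 2 ψ) (b w : ℝ) (e : Fin K → Bool)
    (t : ℝ) : deriv (deriv (auxF ψ b w e)) t =
      (∑ j, (if e j then (1 : ℝ) else 0) * deriv (deriv ψ) ((t - b) / w - (j : ℕ))) / w ^ 2 := by
  have h1 : deriv (auxF ψ b w e) = fun t =>
      ∑ j, ((if e j then (1 : ℝ) else 0) / w) * deriv ψ ((t - b) / w - (j : ℕ)) := by
    funext t
    exact aux_deriv_sum ψ (hψ.differentiable (by norm_num)) b w _ t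
  have hc1 : ContDiff ℝ 1 (deriv ψ) := hψ.deriv'
  rw [h1, aux_deriv_sum (deriv ψ) (hc1.differentiable (by norm_num)) b w, Finset.sum_div]
  refine Finset.sum_congr rfl fun j _ => ?_
  ring

lemma auxF_contDiff {K : ℕ} (ψ : ℝ → ℝ) (hψ : ContDiff ℝ 2 ψ) (b w : ℝ) (e : Fin K → Bool) :
    ContDiff ℝ 2 (auxF ψ b w e) := by
  unfold auxF
  apply ContDiff.sum
  intro j _
  exact contDiff_const.mul (hψ.comp (by fun_prop))

lemma auxF_flip {K : ℕ} (ψ : ℝ → ℝ) (b w : ℝ) (e : Fin K → Bool) (j : Fin K) (t : ℝ) :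
    (auxF ψ b w e t - auxF ψ b w (Function.update e j (!e j)) t) ^ 2
      = ψ ((t - b) / w - (j : ℕ)) ^ 2 := by
  unfold auxF
  rw [← Finset.sum_sub_distrib, Finset.sum_eq_single j]
  · cases h : e j <;> simp
  · intro i _ hij
    simp [Function.update_of_ne hij]
  · simp

lemma auxF_int {K : ℕ} (ψ : ℝ → ℝ) (m : ℝ) (hm : 1 ≤ m) (hψ : ContDiff ℝ 2 ψ)
    (hb : ∀ s, |deriv (deriv ψ) s| ≤ m ^ 2)
    (hz : ∀ s, (s ≤ 0 ∨ 1 ≤ s) → deriv (deriv ψ) s = 0)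
    (h : ℝ) (h0 : 0 < h) (h1 : h ≤ 1) (e : Fin K → Bool) :
    (∫ t in (-1 : ℝ)..1, |deriv (deriv (auxF ψ (1 - h) (m * h ^ 2) e)) t| * (1 - |t|) ^ 3) ≤ 1 := by
  set w := m * h ^ 2 with hw
  have hw0 : 0 < w := by positivity
  set f := auxF ψ (1 - h) w e with hf
  have hfc : ContDiff ℝ 2 f := auxF_contDiff ψ hψ _ _ e
  have hfc1 : ContDiff ℝ 1 (deriv f) := hfc.deriv'
  have hcont : Continuous (deriv (deriv f)) := hfc1.continuous_deriv le_rfl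
  have hint : ∀ a b : ℝ, IntervalIntegrable (fun t => |deriv (deriv f) t| * (1 - |t|) ^ 3)
      volume a b := fun a b => by
    apply Continuous.intervalIntegrable
    fun_prop
  rw [← intervalIntegral.integral_add_adjacent_intervals (hint (-1) (1 - h)) (hint (1 - h) 1)]
  have hI1 : ∫ t in (-1 : ℝ)..(1 - h), |deriv (deriv f) t| * (1 - |t|) ^ 3 = 0 := by
    apply intervalIntegral.integral_zero_ae
    refine Eventually.of_forall fun t ht => ?_
    rw [Set.uIoc_of_le (by linarith)] at ht
    rw [hf, auxF_deriv2 ψ hψ, Finset.sum_eq_zero]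
    · simp
    · intro j _
      rw [hz, mul_zero]
      left
      have : (t - (1 - h)) / w ≤ 0 := div_nonpos_of_nonpos_of_nonneg (by linarith [ht.2]) hw0.le
      have : (0 : ℝ) ≤ (j : ℕ) := by positivity
      linarith
  rw [hI1, zero_add]
  have hbd : ∀ t, |deriv (deriv f) t| ≤ m ^ 2 / w ^ 2 := by
    intro t
    rw [hf, auxF_deriv2 ψ hψ, abs_div, abs_of_pos (show 0 < w ^ 2 by positivity)]
    gcongr
    exact aux_disjoint _ _ hb hz _ (aux_e e) _
  have hI2 := intervalIntegral.norm_integral_le_of_norm_le_const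
    (f := fun t => |deriv (deriv f) t| * (1 - |t|) ^ 3) (a := 1 - h) (b := 1)
    (C := m ^ 2 / w ^ 2 * h ^ 3) (by
      intro t ht
      rw [Set.uIoc_of_le (by linarith)] at ht
      have ht0 : 0 ≤ t := by linarith [ht.1]
      have h1t : 0 ≤ 1 - t := by linarith [ht.2]
      rw [abs_of_nonneg ht0, Real.norm_eq_abs, abs_of_nonneg (by positivity)]
      gcongr
      · exact hbd t
      · linarith [ht.1])
  refine (le_abs_self _).trans (hI2.trans (le_of_eq ?_))
  rw [hw, show (1 : ℝ) - (1 - h) = h by ring, abs_of_pos h0]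
  field_simp


lemma aux_risk_sum {n K : ℕ} (σ : ℝ) (fhat : (Fin n → ℝ × ℝ) → ℝ → ℝ)
    (hm : Measurable (fun p : (Fin n → ℝ × ℝ) × ℝ => fhat p.1 p.2)) (f : ℝ → ℝ)
    (hf : Measurable f) (J : Fin K → Set ℝ) (I : Set ℝ) (hJ : ∀ j, MeasurableSet (J j))
    (hd : Pairwise (Function.onFun Disjoint J)) (hI : ∀ j, J j ⊆ I) :
    ∑ j, auxRisk σ fhat (J j) f ≤ auxRisk σ fhat I f := by
  unfold auxRisk
  rw [← lintegral_finsetSum]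
  · refine lintegral_mono fun ω => ?_
    have h := lintegral_iUnion (μ := volume) hJ hd
      (fun t => ENNReal.ofReal ((fhat (fun i => (ω.1 i, f (ω.1 i) + ω.2 i)) t - f t) ^ 2))
    rw [tsum_fintype] at h
    simp only
    rw [← h]
    exact lintegral_mono_set (Set.iUnion_subset hI)
  · intro j _
    exact (aux_meas_loss fhat hm (J j) f hf).comp
      (g := fun D : Fin n → ℝ × ℝ => ∫⁻ t in J j, ENNReal.ofReal ((fhat D t - f t) ^ 2))
      (f := fun ω : (Fin n → ℝ) × (Fin n → ℝ) => fun i => (ω.1 i, f (ω.1 i) + ω.2 i))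
      (by
        rw [measurable_pi_iff]
        intro i
        have h1 : Measurable (fun ω : (Fin n → ℝ) × (Fin n → ℝ) => ω.1 i) := by fun_prop
        have h2 : Measurable (fun ω : (Fin n → ℝ) × (Fin n → ℝ) => ω.2 i) := by fun_prop
        exact h1.prodMk ((hf.comp h1).add h2))

lemma aux_delta (ψ : ℝ → ℝ) (h1 : ∀ s, |ψ s| ≤ 1) (h0 : ∀ s, (s ≤ 0 ∨ 1 ≤ s) → ψ s = 0)
    (b w : ℝ) (hw : 0 < w) (j : ℕ) (I : Set ℝ) :
    ∫⁻ t in I, ENNReal.ofReal (ψ ((t - b) / w - j) ^ 2) ≤ ENNReal.ofReal w := by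
  refine (setLIntegral_le_lintegral _ _).trans ?_
  have hle : ∀ t, ENNReal.ofReal (ψ ((t - b) / w - j) ^ 2) ≤
      (Set.Icc (b + j * w) (b + (j + 1) * w)).indicator (fun _ => (1 : ℝ≥0∞)) t := by
    intro t
    by_cases ht : t ∈ Set.Icc (b + j * w) (b + (j + 1) * w)
    · rw [Set.indicator_of_mem ht, ← ENNReal.ofReal_one]
      apply ENNReal.ofReal_le_ofReal
      rw [← sq_abs]
      nlinarith [h1 ((t - b) / w - j), abs_nonneg (ψ ((t - b) / w - j))]
    · rw [h0]
      · simp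
      · by_contra! hc
        apply ht
        have e1 : (j : ℝ) < (t - b) / w := by linarith [hc.1]
        have e2 : (t - b) / w < j + 1 := by linarith [hc.2]
        rw [lt_div_iff₀ hw] at e1
        rw [div_lt_iff₀ hw] at e2
        constructor <;> linarith
  refine (lintegral_mono hle).trans ?_
  rw [lintegral_indicator measurableSet_Icc, setLIntegral_const, one_mul, Real.volume_Icc]
  apply ENNReal.ofReal_le_ofReal
  linarith


/-- **Univariate minimax lower bound (d = 1 case of Theorem
`thm: lower_bound_StableMinima`).** -/
theorem minimax_lower_bound_univariate :
    ∃ c > (0 : ℝ), ∃ c' > (0 : ℝ),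
      ∀ (σ : ℝ), 0 < σ → ∀ (n : ℕ), 0 < n → σ ^ 2 / (n : ℝ) ≤ c' →
      ∀ fhat : (Fin n → ℝ × ℝ) → ℝ → ℝ,
        Measurable (fun p : (Fin n → ℝ × ℝ) × ℝ => fhat p.1 p.2) →
        ∃ f : ℝ → ℝ,
          ContDiffOn ℝ 2 f (Set.Icc (-1 : ℝ) 1) ∧
          (∀ t ∈ Set.Icc (-1 : ℝ) 1, |f t| ≤ 1) ∧
          (∫ t in (-1 : ℝ)..1, |deriv (deriv f) t| * (1 - |t|) ^ 3) ≤ 1 ∧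
          ENNReal.ofReal (c * Real.sqrt (σ ^ 2 / (n : ℝ))) ≤
            ∫⁻ ω : (Fin n → ℝ) × (Fin n → ℝ),
                ∫⁻ t in Set.Icc (-1 : ℝ) 1,
                  ENNReal.ofReal
                    ((fhat (fun i => (ω.1 i, f (ω.1 i) + ω.2 i)) t - f t) ^ 2) ∂volume
              ∂((Measure.pi fun _ : Fin n => uniformIcc).prod
                  (Measure.pi fun _ : Fin n => gaussianReal 0 (σ ^ 2).toNNReal)) := by
  obtain ⟨ψ, m, hm1, hψ, hψ1, hψ0, hψJ, hψ2, hψ20⟩ := aux_bump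
  have hm0 : 0 < m := by linarith
  refine ⟨1 / (64 * m), by positivity, 1, one_pos, ?_⟩
  intro σ hσ n hn hle fhat hmeas
  have hn' : (0 : ℝ) < n := by exact_mod_cast hn
  set τ := Real.sqrt (σ ^ 2 / (n : ℝ)) with hτ
  have hτ0 : 0 < τ := Real.sqrt_pos.2 (by positivity)
  have hτ2 : τ ^ 2 = σ ^ 2 / n := Real.sq_sqrt (by positivity)
  have hτ1 : τ ≤ 1 := by
    rw [hτ]; exact Real.sqrt_le_one.2 hle
  set h := τ / (2 * m) with hh
  have hh0 : 0 < h := by positivity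
  have hh1 : h ≤ 1 := by
    rw [hh, div_le_one (by positivity)]; linarith
  set w := m * h ^ 2 with hw
  have hw0 : 0 < w := by positivity
  have hwτ : w = τ ^ 2 / (4 * m) := by
    rw [hw, hh]; field_simp; norm_num
  have hhw : h / w = 2 / τ := by
    rw [hwτ, hh]; field_simp; norm_num
  set K := ⌊h / w⌋₊ with hK
  have hKle : (K : ℝ) * w ≤ h := by
    have : (K : ℝ) ≤ h / w := Nat.floor_le (by positivity)
    rwa [le_div_iff₀ hw0] at this
  have hKge : 1 / τ ≤ K := by
    have h1 : h / w < K + 1 := Nat.lt_floor_add_one _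
    rw [hhw] at h1
    have h2 : 1 ≤ 1 / τ := by rw [le_div_iff₀ hτ0]; linarith
    have h3 : 2 / τ = 1 / τ + 1 / τ := by ring
    linarith
  set F : (Fin K → Bool) → ℝ → ℝ := fun e => auxF ψ (1 - h) w e with hF
  have hFc : ∀ e, ContDiff ℝ 2 (F e) := fun e => auxF_contDiff ψ hψ _ _ e
  have hFm : ∀ e, Measurable (F e) := fun e => (hFc e).continuous.measurable
  set J : Fin K → Set ℝ := fun j =>
    Set.Icc (1 - h + ((j : ℕ) + 1 / 4) * w) (1 - h + ((j : ℕ) + 3 / 4) * w) with hJ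
  have hJm : ∀ j, MeasurableSet (J j) := fun j => measurableSet_Icc
  have hJv : ∀ j, volume (J j) = ENNReal.ofReal (w / 2) := by
    intro j
    rw [hJ, Real.volume_Icc]
    congr 1; ring
  have hJI : ∀ j, J j ⊆ Set.Icc (-1 : ℝ) 1 := by
    intro j t ht
    have hj : ((j : ℕ) : ℝ) + 1 ≤ K := by exact_mod_cast j.2
    have hj0 : (0 : ℝ) ≤ (j : ℕ) := by positivity
    have h1 := ht.1
    have h2 := ht.2
    constructor
    · have : 0 ≤ ((j : ℕ) + 1 / 4 : ℝ) * w := by positivity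
      linarith
    · have : ((j : ℕ) + 3 / 4 : ℝ) * w ≤ K * w := by gcongr; linarith
      linarith
  have hJlt : ∀ i j : Fin K, (i : ℕ) < j → Disjoint (J i) (J j) := by
    intro i j hij
    rw [Set.disjoint_left]
    intro t hi hj
    have h1 : ((i : ℕ) : ℝ) + 1 ≤ (j : ℕ) := by exact_mod_cast hij
    have h2 := hi.2
    have h3 := hj.1
    have h4 : ((i : ℕ) + 3 / 4 : ℝ) * w < ((j : ℕ) + 1 / 4 : ℝ) * w :=
      mul_lt_mul_of_pos_right (by linarith) hw0
    linarith
  have hJd : Pairwise (Function.onFun Disjoint J) := by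
    intro i j hij
    rcases lt_or_gt_of_ne (fun h : (i : ℕ) = j => hij (Fin.ext h)) with h | h
    · exact hJlt i j h
    · exact (hJlt j i h).symm
  obtain ⟨e, he⟩ := aux_assouad (fun e => auxRisk σ fhat (Set.Icc (-1 : ℝ) 1) (F e))
    (fun j e => auxRisk σ fhat (J j) (F e))
    (ENNReal.ofReal (9 / 32) * ENNReal.ofReal (w / 2))
    (fun e => aux_risk_sum σ fhat hmeas (F e) (hFm e) J _ hJm hJd hJI)
    (by
      intro j e
      rw [← hJv j]
      apply aux_pair hn σ hσ fhat hmeas (J j) (hJm j) (by rw [hJv]; simp) (F e) (F _)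
        (hFm _) (hFm _) _ w _ _
      · intro t ht
        have h1 := ht.1
        have h2 := ht.2
        simp only [hF]
        rw [auxF_flip, hψJ]
        · norm_num
        · have : ((j : ℕ) + 1 / 4 : ℝ) ≤ (t - (1 - h)) / w := by
            rw [le_div_iff₀ hw0]; linarith
          linarith
        · have : (t - (1 - h)) / w ≤ ((j : ℕ) + 3 / 4 : ℝ) := by
            rw [div_le_iff₀ hw0]; linarith
          linarith
      · have hsq : ∀ t, (F (Function.update e j (!e j)) t - F e t) ^ 2
            = ψ ((t - (1 - h)) / w - (j : ℕ)) ^ 2 := by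
          intro t
          rw [← auxF_flip ψ (1 - h) w e j t]
          simp only [hF]
          ring
        simp_rw [hsq]
        exact aux_delta ψ hψ1 hψ0 _ w hw0 j _
      · have : n * w / σ ^ 2 = 1 / (4 * m) := by
          rw [hwτ, hτ2]; field_simp
        rw [this]
        apply one_div_le_one_div_of_le <;> linarith)
  refine ⟨F e, (hFc e).contDiffOn, ?_, ?_, ?_⟩
  · intro t _
    exact aux_disjoint ψ 1 hψ1 hψ0 _ (aux_e e) _
  · exact auxF_int ψ m hm1 hψ hψ2 hψ20 h hh0 hh1 e
  · change _ ≤ auxRisk σ fhat (Set.Icc (-1 : ℝ) 1) (F e)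
    have h2 : (2 : ℝ≥0∞) * ENNReal.ofReal (1 / (64 * m) * τ) ≤
        2 * auxRisk σ fhat (Set.Icc (-1 : ℝ) 1) (F e) := by
      refine le_trans ?_ he
      rw [← ENNReal.ofReal_mul (by norm_num), ← ENNReal.ofReal_natCast,
        ← ENNReal.ofReal_mul (by positivity), show (2 : ℝ≥0∞) = ENNReal.ofReal 2 by simp,
        ← ENNReal.ofReal_mul (by norm_num)]
      apply ENNReal.ofReal_le_ofReal
      calc 2 * (1 / (64 * m) * τ) = τ / (32 * m) := by ring
        _ ≤ 9 * τ / (256 * m) := by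
          rw [div_le_div_iff₀ (by positivity) (by positivity)]
          nlinarith [mul_pos hτ0 hm0]
        _ = 1 / τ * (9 / 32 * (w / 2)) := by rw [hwτ]; field_simp; norm_num
        _ ≤ K * (9 / 32 * (w / 2)) := by gcongr
    exact (ENNReal.mul_le_mul_iff_right (by simp) (by simp)).1 h2


end
end

section
/- Let d ≥ 1, let X be uniformly distributed on B_1^d, and let Q(x) = P(X₁ > x) be the tail probability of the first coordinate. Then for all x ∈ [3/4, 1): c₂(d) (1−x)^{(d+1)/2} ≤ Q(x) ≤ c₃(d) (1−x)^{(d+1)/2}, where c₂(d) = (c₁(d)/(d+1)) (7/4)^{(d+1)/2}, c₃(d) = (c₁(d)/(d+1)) 2^{(d+2)/2}, and c₁(d) = Γ(d/2 + 1)/(√π · Γ((d+1)/2)). -/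
open MeasureTheory Real Filter ProbabilityTheory
open scoped ENNReal Classical BigOperators

noncomputable section

def c1 (d : ℕ) : ℝ := Real.Gamma ((d : ℝ) / 2 + 1) / (Real.sqrt π * Real.Gamma (((d : ℝ) + 1) / 2))

def c2 (d : ℕ) : ℝ := c1 d / ((d : ℝ) + 1) * (7 / 4) ^ (((d : ℝ) + 1) / 2)

def c3 (d : ℕ) : ℝ := c1 d / ((d : ℝ) + 1) * 2 ^ (((d : ℝ) + 2) / 2)

def c4 (d : ℕ) : ℝ :=
  (2 * ((d : ℝ) + 1) / ((d : ℝ) + 3)) * (7 / 4) ^ (((d : ℝ) - 1) / 2) / 2 ^ (((d : ℝ) + 2) / 2)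

def c5 (d : ℕ) : ℝ :=
  (2 * ((d : ℝ) + 1) / ((d : ℝ) + 3)) * 2 ^ (((d : ℝ) - 1) / 2) / (7 / 4) ^ (((d : ℝ) + 1) / 2)

def vBall (n : ℕ) : ℝ := √π ^ n / Real.Gamma ((n : ℝ) / 2 + 1)

lemma vBall_pos (n : ℕ) : 0 < vBall n := by
  unfold vBall
  have : 0 < Real.Gamma ((n : ℝ) / 2 + 1) := Real.Gamma_pos_of_pos (by positivity)
  have := Real.pi_pos
  positivity

lemma slice_vol (n : ℕ) (s : ℝ) (hs : 0 ≤ s) :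
    volume {z : Fin n → ℝ | ∑ i, z i ^ 2 ≤ s} = ENNReal.ofReal (√s ^ n * vBall n) := by
  rcases Nat.eq_zero_or_pos n with rfl | hn
  · have : {z : Fin 0 → ℝ | ∑ i, z i ^ 2 ≤ s} = Set.univ := by
      ext z; simp [hs]
    rw [this]
    simp [vBall, volume_pi]
  · haveI : Nonempty (Fin n) := ⟨⟨0, hn⟩⟩
    have h1 := EuclideanSpace.volume_closedBall (Fin n) 0 (√s)
    rw [← (PiLp.volume_preserving_toLp (Fin n)).measure_preimage
      Metric.isClosed_closedBall.measurableSet.nullMeasurableSet] at h1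
    have : (WithLp.toLp 2 ⁻¹' (Metric.closedBall (0 : EuclideanSpace ℝ (Fin n)) (√s)) : Set (Fin n → ℝ))
        = {z : Fin n → ℝ | ∑ i, z i ^ 2 ≤ s} := by
      ext z
      simp [EuclideanSpace.norm_eq, Real.sqrt_le_sqrt_iff hs]
    rw [this] at h1
    rw [h1, ENNReal.ofReal_mul (by positivity), ENNReal.ofReal_pow (by positivity)]
    simp [vBall]

lemma cap_vol (n : ℕ) (x : ℝ) (hx0 : 0 ≤ x) (hx1 : x ≤ 1) :
    volume (Metric.closedBall (0 : Euc (n + 1)) 1 ∩ {y : Euc (n + 1) | x < y 0}) =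
      ENNReal.ofReal (∫ t in x..1, √(1 - t ^ 2) ^ n * vBall n) := by
  have hm : MeasurableSet (Metric.closedBall (0 : Euc (n + 1)) 1 ∩ {y : Euc (n + 1) | x < y 0}) := by
    apply Metric.isClosed_closedBall.measurableSet.inter
    apply IsOpen.measurableSet
    exact isOpen_lt continuous_const (by fun_prop)
  have hmp := (PiLp.volume_preserving_toLp (Fin (n + 1))).comp
    (volume_preserving_piFinSuccAbove (fun _ : Fin (n + 1) => ℝ) 0).symm
  rw [← hmp.measure_preimage hm.nullMeasurableSet, Measure.volume_eq_prod,
    Measure.prod_apply (hmp.measurable hm)]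
  have hf : (fun t : ℝ => volume (Prod.mk t ⁻¹' ((WithLp.toLp 2 ∘
      (MeasurableEquiv.piFinSuccAbove (fun _ : Fin (n + 1) => ℝ) 0).symm) ⁻¹'
        (Metric.closedBall (0 : Euc (n + 1)) 1 ∩ {y : Euc (n + 1) | x < y 0})))) =
      (Set.Ioc x 1).indicator (fun t => ENNReal.ofReal (√(1 - t ^ 2) ^ n * vBall n)) := by
    funext t
    have key : (Prod.mk t ⁻¹' ((WithLp.toLp 2 ∘
      (MeasurableEquiv.piFinSuccAbove (fun _ : Fin (n + 1) => ℝ) 0).symm) ⁻¹'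
        (Metric.closedBall (0 : Euc (n + 1)) 1 ∩ {y : Euc (n + 1) | x < y 0}))) =
        {z : Fin n → ℝ | t ^ 2 + ∑ i, z i ^ 2 ≤ 1 ∧ x < t} := by
      ext z
      simp [EuclideanSpace.norm_eq, Fin.sum_univ_succ, MeasurableEquiv.piFinSuccAbove_symm_apply]
    rw [key]
    by_cases ht : t ∈ Set.Ioc x 1
    · rw [Set.indicator_of_mem ht, ← slice_vol n _ (by nlinarith [ht.1, ht.2])]
      congr 1
      ext z
      simp only [Set.mem_setOf_eq]
      constructor
      · rintro ⟨h, -⟩; linarith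
      · intro h; exact ⟨by linarith, ht.1⟩
    · rw [Set.indicator_of_notMem ht]
      have : {z : Fin n → ℝ | t ^ 2 + ∑ i, z i ^ 2 ≤ 1 ∧ x < t} = ∅ := by
        ext z
        simp only [Set.mem_setOf_eq, Set.mem_empty_iff_false, iff_false]
        rintro ⟨h, h2⟩
        apply ht
        refine ⟨h2, ?_⟩
        have : 0 ≤ ∑ i, z i ^ 2 := Finset.sum_nonneg fun i _ => sq_nonneg _
        nlinarith
      rw [this, measure_empty]
  rw [hf, lintegral_indicator measurableSet_Ioc, intervalIntegral.integral_of_le hx1,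
    ofReal_integral_eq_lintegral_ofReal]
  · have : Continuous fun t : ℝ => √(1 - t ^ 2) ^ n * vBall n := by fun_prop
    exact (this.intervalIntegrable x 1).1
  · exact Eventually.of_forall fun t => mul_nonneg (by positivity) (vBall_pos n).le

lemma int_pow (n : ℕ) (x : ℝ) :
    ∫ t in x..1, (1 - t) ^ ((n : ℝ) / 2) = (1 - x) ^ ((n : ℝ) / 2 + 1) / ((n : ℝ) / 2 + 1) := by
  have hn : (0 : ℝ) ≤ n := Nat.cast_nonneg n
  rw [intervalIntegral.integral_comp_sub_left (fun t => t ^ ((n : ℝ) / 2)) 1,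
    integral_rpow (Or.inl (by linarith)), sub_self, Real.zero_rpow (by positivity), sub_zero]

lemma sqrt_pow_eq (n : ℕ) (s : ℝ) (hs : 0 ≤ s) : √s ^ n = s ^ ((n : ℝ) / 2) := by
  rw [Real.sqrt_eq_rpow, ← Real.rpow_natCast, ← Real.rpow_mul hs]
  congr 1; ring

lemma int_bounds (n : ℕ) (x : ℝ) (hx0 : 3 / 4 ≤ x) (hx1 : x < 1) :
    (7 / 4 : ℝ) ^ ((n : ℝ) / 2) * ((1 - x) ^ ((n : ℝ) / 2 + 1) / ((n : ℝ) / 2 + 1)) ≤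
      ∫ t in x..1, √(1 - t ^ 2) ^ n ∧
    ∫ t in x..1, √(1 - t ^ 2) ^ n ≤
      (2 : ℝ) ^ ((n : ℝ) / 2) * ((1 - x) ^ ((n : ℝ) / 2 + 1) / ((n : ℝ) / 2 + 1)) := by
  have hn : (0 : ℝ) ≤ (n : ℝ) / 2 := by positivity
  have hc : Continuous fun t : ℝ => √(1 - t ^ 2) ^ n := by fun_prop
  have hc2 (a : ℝ) : Continuous fun t : ℝ => a * (1 - t) ^ ((n : ℝ) / 2) :=
    continuous_const.mul (Continuous.rpow_const (by fun_prop) fun _ => Or.inr hn)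
  rw [← int_pow, ← intervalIntegral.integral_const_mul, ← intervalIntegral.integral_const_mul]
  constructor
  · refine intervalIntegral.integral_mono_on hx1.le ((hc2 _).intervalIntegrable _ _)
      (hc.intervalIntegrable _ _) fun t ht => ?_
    have h1 : 0 ≤ 1 - t := by linarith [ht.2]
    have h2 := ht.1
    rw [sqrt_pow_eq n _ (by nlinarith), ← Real.mul_rpow (by norm_num) h1]
    exact Real.rpow_le_rpow (by positivity) (by nlinarith) hn
  · refine intervalIntegral.integral_mono_on hx1.le (hc.intervalIntegrable _ _)
      ((hc2 _).intervalIntegrable _ _) fun t ht => ?_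
    have h1 : 0 ≤ 1 - t := by linarith [ht.2]
    have h2 := ht.1
    rw [sqrt_pow_eq n _ (by nlinarith), ← Real.mul_rpow (by norm_num) h1]
    exact Real.rpow_le_rpow (by nlinarith) (by nlinarith) hn

lemma c1_eq (n : ℕ) : c1 (n + 1) = vBall n / vBall (n + 1) := by
  have h1 : 0 < Real.Gamma ((n : ℝ) / 2 + 1) := Real.Gamma_pos_of_pos (by positivity)
  have h2 : 0 < Real.Gamma (((n : ℝ) + 1) / 2 + 1) := Real.Gamma_pos_of_pos (by positivity)
  have h3 : 0 < √π := Real.sqrt_pos.mpr Real.pi_pos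
  have h4 : ((n : ℝ) + 1 + 1) / 2 = (n : ℝ) / 2 + 1 := by ring
  unfold c1 vBall
  push_cast
  rw [h4]
  field_simp
  ring

lemma tail_eq (n : ℕ) (x : ℝ) (hx0 : 3 / 4 ≤ x) (hx1 : x < 1) :
    ((uniformBall (n + 1)) {y : Euc (n + 1) | x < y 0}).toReal =
      c1 (n + 1) * ∫ t in x..1, √(1 - t ^ 2) ^ n := by
  have hm : MeasurableSet {y : Euc (n + 1) | x < y 0} :=
    (isOpen_lt continuous_const (by fun_prop)).measurableSet
  have hv : volume (Metric.closedBall (0 : Euc (n + 1)) 1) = ENNReal.ofReal (vBall (n + 1)) := by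
    rw [EuclideanSpace.volume_closedBall]; simp [vBall]
  have hi : 0 ≤ ∫ t in x..1, √(1 - t ^ 2) ^ n * vBall n :=
    intervalIntegral.integral_nonneg hx1.le fun t _ => mul_nonneg (by positivity) (vBall_pos n).le
  rw [uniformBall, Measure.smul_apply, Measure.restrict_apply hm, Set.inter_comm,
    cap_vol n x (by linarith) hx1.le, hv, smul_eq_mul, ENNReal.toReal_mul, ENNReal.toReal_inv,
    ENNReal.toReal_ofReal (vBall_pos _).le, ENNReal.toReal_ofReal hi,
    intervalIntegral.integral_mul_const, c1_eq]
  ring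

/-- **Tail probability of the first coordinate (Proposition
`prop: spherical_tail_bound`).** -/
theorem tail_probability_bounds (d : ℕ) (hd : 0 < d)
    (x : ℝ) (hx : x ∈ Set.Ico (3 / 4 : ℝ) 1) :
    c2 d * (1 - x) ^ (((d : ℝ) + 1) / 2) ≤
        ((uniformBall d) {y : Euc d | x < y ⟨0, hd⟩}).toReal ∧
      ((uniformBall d) {y : Euc d | x < y ⟨0, hd⟩}).toReal ≤
        c3 d * (1 - x) ^ (((d : ℝ) + 1) / 2) := by
  obtain ⟨n, rfl⟩ : ∃ n, d = n + 1 := ⟨d - 1, by omega⟩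
  have e := tail_eq n x hx.1 hx.2
  have e0 : (⟨0, hd⟩ : Fin (n + 1)) = 0 := rfl
  rw [e0, e]
  obtain ⟨hl, hu⟩ := int_bounds n x hx.1 hx.2
  have hc : 0 ≤ c1 (n + 1) := by
    rw [c1_eq]; exact (div_pos (vBall_pos _) (vBall_pos _)).le
  have hn : (0 : ℝ) ≤ n := Nat.cast_nonneg n
  have h1x : 0 < 1 - x := by linarith [hx.2]
  have e1 : (((n + 1 : ℕ) : ℝ) + 1) / 2 = (n : ℝ) / 2 + 1 := by push_cast; ring
  have e2 : (((n + 1 : ℕ) : ℝ) + 2) / 2 = (n : ℝ) / 2 + 1 + 1 / 2 := by push_cast; ring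
  have e3 : (((n + 1 : ℕ) : ℝ) + 1) = 2 * ((n : ℝ) / 2 + 1) := by push_cast; ring
  unfold c2 c3
  rw [e1, e2, e3]
  have hA : 0 ≤ (1 - x) ^ ((n : ℝ) / 2 + 1) := by positivity
  generalize (1 - x) ^ ((n : ℝ) / 2 + 1) = A at *
  constructor
  · refine le_trans ?_ (mul_le_mul_of_nonneg_left hl hc)
    rw [Real.rpow_add (by norm_num : (0 : ℝ) < 7 / 4), Real.rpow_one]
    have hB : 0 ≤ (7 / 4 : ℝ) ^ ((n : ℝ) / 2) := by positivity
    generalize (7 / 4 : ℝ) ^ ((n : ℝ) / 2) = B at *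
    have : 0 ≤ c1 (n + 1) * (B * (A / ((n : ℝ) / 2 + 1))) := by positivity
    calc _ = (7 / 8) * (c1 (n + 1) * (B * (A / ((n : ℝ) / 2 + 1)))) := by
          field_simp; ring
      _ ≤ _ := by linarith
  · refine le_trans (mul_le_mul_of_nonneg_left hu hc) ?_
    rw [Real.rpow_add (by norm_num : (0 : ℝ) < 2), Real.rpow_add (by norm_num : (0 : ℝ) < 2),
      Real.rpow_one]
    have hB : 0 ≤ (2 : ℝ) ^ ((n : ℝ) / 2) := by positivity
    have hD : 1 ≤ (2 : ℝ) ^ (1 / 2 : ℝ) := Real.one_le_rpow (by norm_num) (by norm_num)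
    generalize (2 : ℝ) ^ ((n : ℝ) / 2) = B at *
    generalize (2 : ℝ) ^ (1 / 2 : ℝ) = D at *
    have : 0 ≤ c1 (n + 1) * (B * (A / ((n : ℝ) / 2 + 1))) := by positivity
    calc _ ≤ D * (c1 (n + 1) * (B * (A / ((n : ℝ) / 2 + 1)))) := by nlinarith
      _ = _ := by field_simp

end
end

section
/- Let d ≥ 1 and let X be uniformly distributed on B_1^d. For every x ∈ [3/4, 1) the conditional expectation E[X₁ | X₁ > x] is well defined (since P(X₁ > x) > 0) and satisfies 1 − c₅(d)(1−x) ≤ E[X₁ | X₁ > x] ≤ 1 − c₄(d)(1−x), where c₄(d) = (2(d+1)/(d+3)) · (7/4)^{(d−1)/2} / 2^{(d+2)/2} and c₅(d) = (2(d+1)/(d+3)) · 2^{(d−1)/2} / (7/4)^{(d+1)/2}. -/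
open MeasureTheory Real Filter ProbabilityTheory
open scoped ENNReal Classical BigOperators

noncomputable section

lemma aux_mp (n : ℕ) : MeasurePreserving
    (fun y : Euc (n+1) => ((y 0, WithLp.toLp 2 (fun i : Fin n => y i.succ)) : ℝ × Euc n))
    volume volume := by
  have h1 := PiLp.volume_preserving_ofLp (Fin (n+1))
  have h2 := volume_preserving_piFinSuccAbove (fun _ : Fin (n+1) => ℝ) 0
  have h3 : MeasurePreserving (Prod.map id (WithLp.toLp 2) : ℝ × (Fin n → ℝ) → ℝ × Euc n)
      volume volume :=
    (MeasurePreserving.id (volume : Measure ℝ)).prod (PiLp.volume_preserving_toLp (Fin n))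
  exact h3.comp (h2.comp h1)

lemma aux_slice (n : ℕ) (S : Set ℝ) (hS : MeasurableSet S) :
    volume ({y : Euc (n+1) | y 0 ∈ S} ∩ Metric.closedBall 0 1) =
      ∫⁻ t in S ∩ Set.Icc (-1) 1, ENNReal.ofReal (√(1 - t^2) ^ n)
        * volume (Metric.closedBall (0 : Euc n) 1) := by
  set T : Set (ℝ × Euc n) := {p | p.1 ∈ S ∧ p.1^2 + ‖p.2‖^2 ≤ 1} with hT
  have hTm : MeasurableSet T :=
    (measurable_fst hS).inter (measurableSet_le
      (f := fun p : ℝ × Euc n => p.1^2 + ‖p.2‖^2) (by fun_prop) measurable_const)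
  have hpre : {y : Euc (n+1) | y 0 ∈ S} ∩ Metric.closedBall 0 1 =
      (fun y : Euc (n+1) => ((y 0, WithLp.toLp 2 (fun i : Fin n => y i.succ)) : ℝ × Euc n)) ⁻¹' T := by
    ext y
    simp only [Set.mem_inter_iff, Set.mem_setOf_eq, Metric.mem_closedBall, dist_zero_right,
      Set.mem_preimage, hT]
    refine and_congr_right fun _ => ?_
    rw [← sq_le_one_iff₀ (norm_nonneg y), EuclideanSpace.real_norm_sq_eq,
      EuclideanSpace.real_norm_sq_eq, Fin.sum_univ_succ]
  rw [hpre, (aux_mp n).measure_preimage hTm.nullMeasurableSet]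
  change (volume.prod volume) T = _
  rw [Measure.prod_apply hTm, ← lintegral_indicator (hS.inter measurableSet_Icc)]
  refine lintegral_congr fun t => ?_
  by_cases ht : t ∈ S ∩ Set.Icc (-1) 1
  · rw [Set.indicator_of_mem ht]
    have h0 : 0 ≤ 1 - t^2 := by nlinarith [ht.2.1, ht.2.2]
    have : Prod.mk t ⁻¹' T = Metric.closedBall (0 : Euc n) (√(1 - t^2)) := by
      ext z
      simp only [hT, Set.mem_preimage, Set.mem_setOf_eq, Metric.mem_closedBall, dist_zero_right,
        ht.1, true_and]
      rw [Real.le_sqrt (norm_nonneg _) h0]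
      constructor <;> intro h <;> linarith
    rw [this, Measure.addHaar_closedBall' _ _ (Real.sqrt_nonneg _)]
    simp
  · rw [Set.indicator_of_notMem ht]
    have : Prod.mk t ⁻¹' T = ∅ := by
      ext z
      simp only [hT, Set.mem_preimage, Set.mem_setOf_eq, Set.mem_empty_iff_false, iff_false, not_and]
      intro h1 h2
      refine ht ⟨h1, ?_⟩
      have := sq_nonneg ‖z‖
      constructor <;> nlinarith
    rw [this]; simp

lemma aux_map (n : ℕ) : ∃ k : ℝ≥0∞, k ≠ 0 ∧ k ≠ ∞ ∧
    (uniformBall (n+1)).map (fun y : Euc (n+1) => y 0) =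
      k • (volume.restrict (Set.Icc (-1) 1)).withDensity
        (fun t : ℝ => ENNReal.ofReal (√(1 - t^2) ^ n)) := by
  refine ⟨(volume (Metric.closedBall (0 : Euc (n+1)) 1))⁻¹ *
    volume (Metric.closedBall (0 : Euc n) 1), ?_, ?_, ?_⟩
  · exact mul_ne_zero (ENNReal.inv_ne_zero.2 (isCompact_closedBall _ _).measure_lt_top.ne)
      (Metric.measure_closedBall_pos volume _ one_pos).ne'
  · exact ENNReal.mul_ne_top
      (ENNReal.inv_ne_top.2 (Metric.measure_closedBall_pos volume _ one_pos).ne')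
      (isCompact_closedBall _ _).measure_lt_top.ne
  · ext S hS
    have hm : Measurable (fun y : Euc (n+1) => y 0) := by fun_prop
    have hw : Measurable (fun t : ℝ => ENNReal.ofReal (√(1 - t^2) ^ n)) := by fun_prop
    rw [Measure.map_apply hm hS, uniformBall, Measure.smul_apply, Measure.restrict_apply (hm hS),
      Measure.smul_apply, withDensity_apply _ hS, Measure.restrict_restrict hS]
    have := aux_slice n S hS
    rw [lintegral_mul_const _ hw] at this
    change _ • volume ({y : Euc (n+1) | y 0 ∈ S} ∩ Metric.closedBall 0 1) = _
    rw [this, smul_eq_mul, smul_eq_mul, mul_comm (∫⁻ _ in _, _), mul_assoc]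

lemma aux_int (n : ℕ) : ∃ k : ℝ, 0 < k ∧ ∀ x ∈ Set.Ico (3/4 : ℝ) 1, ∀ g : ℝ → ℝ, Continuous g →
    ∫ y in {y : Euc (n+1) | x < y 0}, g (y 0) ∂uniformBall (n+1) =
      k * ∫ t in x..1, √(1 - t^2) ^ n * g t := by
  obtain ⟨k, hk0, hk1, hk⟩ := aux_map n
  refine ⟨k.toReal, ENNReal.toReal_pos hk0 hk1, fun x hx g hg => ?_⟩
  have hm : Measurable (fun y : Euc (n+1) => y 0) := by fun_prop
  have h1 := setIntegral_map (μ := uniformBall (n+1)) (g := fun y : Euc (n+1) => y 0)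
    (f := g) (s := Set.Ioi x) measurableSet_Ioi hg.aestronglyMeasurable hm.aemeasurable
  have hw : Measurable (fun t : ℝ => ENNReal.ofReal (√(1 - t^2) ^ n)) := by fun_prop
  change _ = ∫ y in {y : Euc (n+1) | x < y 0}, g (y 0) ∂uniformBall (n+1) at h1
  rw [← h1, hk, Measure.restrict_smul, integral_smul_measure,
    setIntegral_withDensity_eq_setIntegral_toReal_smul hw (by simp) _ measurableSet_Ioi,
    Measure.restrict_restrict measurableSet_Ioi, intervalIntegral.integral_of_le hx.2.le]
  have : Set.Ioi x ∩ Set.Icc (-1) 1 = Set.Ioc x 1 := by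
    ext t; simp only [Set.mem_inter_iff, Set.mem_Ioi, Set.mem_Icc, Set.mem_Ioc]
    have := hx.1
    constructor
    · rintro ⟨a, b, c⟩; exact ⟨a, c⟩
    · rintro ⟨a, b⟩; exact ⟨a, by linarith, b⟩
  rw [this, smul_eq_mul]
  congr 1
  refine integral_congr_ae (Filter.Eventually.of_forall fun t => ?_)
  simp only [smul_eq_mul]
  rw [ENNReal.toReal_ofReal (by positivity)]

lemma aux_pow (n : ℕ) (s : ℝ) (hs : 0 ≤ s) : √s ^ n = s ^ ((n:ℝ)/2) := by
  rw [Real.sqrt_eq_rpow, ← Real.rpow_natCast, ← Real.rpow_mul hs]; congr 1; ring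

lemma aux_I0 (n : ℕ) (x : ℝ) (hx : x < 1) :
    ∫ t in x..1, √(1 - t) ^ n = (1-x) ^ ((n:ℝ)/2+1) / ((n:ℝ)/2+1) := by
  rw [intervalIntegral.integral_comp_sub_left (fun s => √s ^ n) 1, sub_self]
  have : ∫ s in (0:ℝ)..(1-x), √s ^ n = ∫ s in (0:ℝ)..(1-x), s ^ ((n:ℝ)/2) := by
    refine intervalIntegral.integral_congr fun s hs => ?_
    rw [Set.uIcc_of_le (by linarith)] at hs
    exact aux_pow n s hs.1
  have hn : (0:ℝ) ≤ n := Nat.cast_nonneg n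
  rw [this, integral_rpow (Or.inl (by linarith)), Real.zero_rpow (by positivity), sub_zero]

lemma aux_I1 (n : ℕ) (x : ℝ) (hx : x < 1) :
    ∫ t in x..1, √(1 - t) ^ n * (1 - t) = (1-x) ^ ((n:ℝ)/2+2) / ((n:ℝ)/2+2) := by
  have : ∫ t in x..1, √(1 - t) ^ n * (1 - t) = ∫ t in x..1, √(1 - t) ^ (n+2) := by
    refine intervalIntegral.integral_congr fun t ht => ?_
    rw [Set.uIcc_of_le hx.le] at ht
    rw [pow_add, Real.sq_sqrt (by linarith [ht.2])]
  rw [this, aux_I0 _ _ hx]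
  push_cast
  ring_nf

lemma aux_w (n : ℕ) (x t : ℝ) (hx : 3/4 ≤ x) (ht : t ∈ Set.Icc x 1) :
    √(7/4) ^ n * √(1-t)^n ≤ √(1 - t^2)^n ∧ √(1 - t^2)^n ≤ √2 ^ n * √(1-t)^n := by
  obtain ⟨h1, h2⟩ := ht
  rw [← mul_pow, ← mul_pow, ← Real.sqrt_mul (by norm_num), ← Real.sqrt_mul (by norm_num)]
  constructor
  · refine pow_le_pow_left₀ (Real.sqrt_nonneg _) (Real.sqrt_le_sqrt ?_) n
    nlinarith
  · refine pow_le_pow_left₀ (Real.sqrt_nonneg _) (Real.sqrt_le_sqrt ?_) n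
    nlinarith

lemma aux_bounds (n : ℕ) (x : ℝ) (hx : x ∈ Set.Ico (3/4 : ℝ) 1) :
    0 < ∫ t in x..1, √(1 - t^2) ^ n ∧
    c4 (n+1) * (1-x) * (∫ t in x..1, √(1 - t^2) ^ n) ≤ ∫ t in x..1, √(1 - t^2) ^ n * (1 - t) ∧
    ∫ t in x..1, √(1 - t^2) ^ n * (1 - t) ≤ c5 (n+1) * (1-x) * (∫ t in x..1, √(1 - t^2) ^ n) := by
  obtain ⟨hx1, hx2⟩ := hx
  have hI0 := aux_I0 n x hx2
  have hI1 := aux_I1 n x hx2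
  set I0 := ∫ t in x..1, √(1 - t) ^ n with hI0d
  set I1 := ∫ t in x..1, √(1 - t) ^ n * (1 - t) with hI1d
  have a1 : √(7/4) ^ n * I0 ≤ ∫ t in x..1, √(1 - t^2) ^ n := by
    rw [hI0d, ← intervalIntegral.integral_const_mul]
    refine intervalIntegral.integral_mono_on hx2.le
      (Continuous.intervalIntegrable (by fun_prop) _ _)
      (Continuous.intervalIntegrable (by fun_prop) _ _) fun t ht => (aux_w n x t hx1 ht).1
  have a2 : ∫ t in x..1, √(1 - t^2) ^ n ≤ √2 ^ n * I0 := by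
    rw [hI0d, ← intervalIntegral.integral_const_mul]
    refine intervalIntegral.integral_mono_on hx2.le
      (Continuous.intervalIntegrable (by fun_prop) _ _)
      (Continuous.intervalIntegrable (by fun_prop) _ _) fun t ht => (aux_w n x t hx1 ht).2
  have a3 : √(7/4) ^ n * I1 ≤ ∫ t in x..1, √(1 - t^2) ^ n * (1 - t) := by
    rw [hI1d, ← intervalIntegral.integral_const_mul]
    refine intervalIntegral.integral_mono_on hx2.le
      (Continuous.intervalIntegrable (by fun_prop) _ _)
      (Continuous.intervalIntegrable (by fun_prop) _ _) fun t ht => ?_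
    rw [← mul_assoc]
    exact mul_le_mul_of_nonneg_right (aux_w n x t hx1 ht).1 (by linarith [ht.2])
  have a4 : ∫ t in x..1, √(1 - t^2) ^ n * (1 - t) ≤ √2 ^ n * I1 := by
    rw [hI1d, ← intervalIntegral.integral_const_mul]
    refine intervalIntegral.integral_mono_on hx2.le
      (Continuous.intervalIntegrable (by fun_prop) _ _)
      (Continuous.intervalIntegrable (by fun_prop) _ _) fun t ht => ?_
    rw [← mul_assoc]
    exact mul_le_mul_of_nonneg_right (aux_w n x t hx1 ht).2 (by linarith [ht.2])
  have hh : 0 < 1 - x := by linarith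
  have hn : (0:ℝ) ≤ n := Nat.cast_nonneg n
  have hI0p : 0 < I0 := by rw [hI0]; positivity
  have hI1p : 0 < I1 := by rw [hI1]; positivity
  have hrel : (1-x) * I0 * (((n:ℝ)+2)/((n:ℝ)+4)) = I1 := by
    rw [hI0, hI1, show (n:ℝ)/2+2 = ((n:ℝ)/2+1)+1 by ring, Real.rpow_add_one hh.ne' ((n:ℝ)/2+1)]
    generalize (1-x) ^ ((n:ℝ)/2+1) = r
    field_simp
    ring
  set p := √(7/4) ^ n with hp
  set q := √2 ^ n with hq
  have hpp : 0 < p := by positivity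
  have hqp : 0 < q := by positivity
  have h4 : c4 (n+1) = (2 * (((n:ℝ)+2)/((n:ℝ)+4))) * p / (q * (2 * √2)) := by
    rw [hp, hq, aux_pow _ _ (by norm_num), aux_pow _ _ (by norm_num), c4]
    push_cast
    rw [show ((n:ℝ)+1+2)/2 = (n:ℝ)/2 + 1 + 1/2 by ring, Real.rpow_add (by norm_num),
      Real.rpow_add_one (by norm_num), ← Real.sqrt_eq_rpow]
    ring_nf
  have h5 : c5 (n+1) = (2 * (((n:ℝ)+2)/((n:ℝ)+4))) * q / (p * (7/4)) := by
    rw [hp, hq, aux_pow _ _ (by norm_num), aux_pow _ _ (by norm_num), c5]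
    push_cast
    rw [show ((n:ℝ)+1+1)/2 = (n:ℝ)/2 + 1 by ring, Real.rpow_add_one (by norm_num)]
    ring_nf
  have hs2 : 1 ≤ √2 := Real.one_le_sqrt.2 (by norm_num)
  refine ⟨lt_of_lt_of_le (by positivity) a1, ?_, ?_⟩
  · refine le_trans ?_ a3
    have hc : 0 ≤ c4 (n+1) * (1-x) := by rw [h4]; positivity
    refine (mul_le_mul_of_nonneg_left a2 hc).trans ?_
    have : c4 (n+1) * (1-x) * (q * I0) = p * I1 / √2 := by
      rw [h4, ← hrel]; field_simp
    rw [this]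
    exact div_le_self (by positivity) hs2
  · refine a4.trans ?_
    have hc : 0 ≤ c5 (n+1) * (1-x) := by rw [h5]; positivity
    refine le_trans ?_ (mul_le_mul_of_nonneg_left a1 hc)
    have : c5 (n+1) * (1-x) * (p * I0) = q * I1 * (8/7) := by
      rw [h5, ← hrel]; field_simp; norm_num
    rw [this]
    nlinarith [mul_pos hqp hI1p]

/-- **Conditional expectation of the first coordinate (Proposition
`prop: spherical_conditional_expection`).** -/
theorem conditional_expectation_bounds (d : ℕ) (hd : 0 < d)
    (x : ℝ) (hx : x ∈ Set.Ico (3 / 4 : ℝ) 1) :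
    0 < (uniformBall d) {y : Euc d | x < y ⟨0, hd⟩} ∧
    1 - c5 d * (1 - x) ≤
      (∫ y in {y : Euc d | x < y ⟨0, hd⟩}, y ⟨0, hd⟩ ∂uniformBall d) /
        ((uniformBall d) {y : Euc d | x < y ⟨0, hd⟩}).toReal ∧
    (∫ y in {y : Euc d | x < y ⟨0, hd⟩}, y ⟨0, hd⟩ ∂uniformBall d) /
        ((uniformBall d) {y : Euc d | x < y ⟨0, hd⟩}).toReal ≤
      1 - c4 d * (1 - x) := by
  obtain ⟨n, rfl⟩ : ∃ n, d = n + 1 := ⟨d - 1, by omega⟩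
  obtain ⟨k, hk, hint⟩ := aux_int n
  obtain ⟨hW, hb4, hb5⟩ := aux_bounds n x hx
  have e1 := hint x hx (fun _ => 1) continuous_const
  have e2 := hint x hx (fun t => t) continuous_id
  have e0 : (⟨0, hd⟩ : Fin (n+1)) = 0 := rfl
  rw [e0]
  simp only [mul_one] at e1
  rw [setIntegral_const, smul_eq_mul, mul_one] at e1
  change ((uniformBall (n+1)) {y : Euc (n+1) | x < y 0}).toReal = _ at e1
  have hd1 : ∫ t in x..1, √(1 - t^2) ^ n * (1 - t) =
      (∫ t in x..1, √(1 - t^2) ^ n) - ∫ t in x..1, √(1 - t^2) ^ n * t := by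
    rw [← intervalIntegral.integral_sub
      (Continuous.intervalIntegrable (by fun_prop) _ _)
      (Continuous.intervalIntegrable (by fun_prop) _ _)]
    congr 1; ext t; ring
  rw [hd1] at hb4 hb5
  rw [e2, e1, mul_div_mul_left _ _ hk.ne', le_div_iff₀ hW, div_le_iff₀ hW]
  refine ⟨?_, by linarith, by linarith⟩
  have : 0 < ((uniformBall (n+1)) {y : Euc (n+1) | x < y 0}).toReal := by
    rw [e1]; positivity
  exact (ENNReal.toReal_pos_iff.1 this).1

end
end

section
/- Let d ≥ 2, let u ∈ S^{d−1} be a unit vector and let 0 < ε < 1/2. Then the squared L² norm over the unit ball of the ReLU atom φ_{u,ε²}(x) = max(uᵀx − (1−ε²), 0) satisfies V_{d−1} (7/4)^{(d−1)/2} I_d · ε^{d+5} ≤ ∫_{B_1^d} max(uᵀx − (1−ε²), 0)² dx ≤ V_{d−1} 2^{(d−1)/2} I_d · ε^{d+5}, where V_{d−1} = π^{(d−1)/2}/Γ((d+1)/2) is the volume of the (d−1)-dimensional unit ball and I_d = ∫_0^1 (1−s)² s^{(d−1)/2} ds. -/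
open MeasureTheory Real Filter ProbabilityTheory
open scoped ENNReal Classical BigOperators

noncomputable section

lemma slice_vol_s16 (m : ℕ) (hm : 1 ≤ m) (t : ℝ) (ht : t ^ 2 ≤ 1) :
    volume.real {w : Fin m → ℝ | t ^ 2 + ∑ i, w i ^ 2 ≤ 1} =
      (π ^ ((m : ℝ) / 2) / Real.Gamma ((m : ℝ) / 2 + 1)) * (1 - t ^ 2) ^ ((m : ℝ) / 2) := by
  haveI : Nonempty (Fin m) := ⟨⟨0, hm⟩⟩
  have h0 : 0 ≤ 1 - t ^ 2 := by linarith
  have h1 := (EuclideanSpace.volume_preserving_symm_measurableEquiv_toLp (Fin m)).measure_preimage_equiv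
    {w : Fin m → ℝ | t ^ 2 + ∑ i, w i ^ 2 ≤ 1}
  have h2 : (⇑(MeasurableEquiv.toLp 2 (Fin m → ℝ)).symm ⁻¹' {w : Fin m → ℝ | t ^ 2 + ∑ i, w i ^ 2 ≤ 1})
      = Metric.closedBall (0 : EuclideanSpace ℝ (Fin m)) (√(1 - t ^ 2)) := by
    ext z
    simp only [Set.mem_preimage, Set.mem_setOf_eq, mem_closedBall_zero_iff]
    rw [EuclideanSpace.norm_eq, Real.sqrt_le_sqrt_iff h0]
    simp only [Real.norm_eq_abs, sq_abs]
    change t ^ 2 + ∑ i, z i ^ 2 ≤ 1 ↔ _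
    constructor <;> intro h <;> linarith
  rw [h2, EuclideanSpace.volume_closedBall] at h1
  rw [measureReal_def, ← h1]
  have hG : 0 < Real.Gamma ((m : ℝ) / 2 + 1) := Real.Gamma_pos_of_pos (by positivity)
  simp only [Fintype.card_fin]
  rw [ENNReal.toReal_mul, ENNReal.toReal_pow, ENNReal.toReal_ofReal (Real.sqrt_nonneg _),
    ENNReal.toReal_ofReal (by positivity)]
  have hs : ∀ x : ℝ, 0 ≤ x → √x ^ m = x ^ ((m : ℝ) / 2) := by
    intro x hx
    rw [Real.sqrt_eq_rpow, ← Real.rpow_natCast, ← Real.rpow_mul hx]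
    congr 1; ring
  rw [hs _ h0, hs _ Real.pi_pos.le]
  ring

lemma slice_int (m : ℕ) (hm : 1 ≤ m) (u : EuclideanSpace ℝ (Fin (m + 1))) (hu : ‖u‖ = 1)
    (F : ℝ → ℝ) (hF : Continuous F) :
    ∫ z in Metric.closedBall (0 : EuclideanSpace ℝ (Fin (m + 1))) 1, F (∑ j, u j * z j) =
      ∫ t, if t ^ 2 ≤ 1 then F t * ((π ^ ((m : ℝ) / 2) / Real.Gamma ((m : ℝ) / 2 + 1)) *
        (1 - t ^ 2) ^ ((m : ℝ) / 2)) else 0 := by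
  obtain ⟨b, hb⟩ := Orthonormal.exists_orthonormalBasis_extension_of_card_eq (𝕜 := ℝ)
    (E := EuclideanSpace ℝ (Fin (m + 1))) (ι := Fin (m + 1)) (by simp) (v := fun _ => u)
    (s := {0}) (by
      rw [orthonormal_iff_ite]
      rintro ⟨i, hi⟩ ⟨j, hj⟩
      simp only [Set.mem_singleton_iff] at hi hj
      subst hi; subst hj
      simp [Set.domRestrict, hu])
  have hb0 : b 0 = u := hb 0 rfl
  let Ψ : EuclideanSpace ℝ (Fin (m + 1)) ≃ᵐ ℝ × (Fin m → ℝ) :=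
    (b.repr.toHomeomorph.toMeasurableEquiv.trans (MeasurableEquiv.toLp 2 (Fin (m + 1) → ℝ)).symm).trans
      (MeasurableEquiv.piFinSuccAbove (fun _ => ℝ) 0)
  have hΨ : MeasurePreserving Ψ volume volume :=
    (volume_preserving_piFinSuccAbove (fun _ : Fin (m + 1) => ℝ) 0).comp
      ((EuclideanSpace.volume_preserving_symm_measurableEquiv_toLp (Fin (m + 1))).comp
        b.measurePreserving_repr)
  have hΨ1 : ∀ z, (Ψ z).1 = b.repr z 0 := fun z => rfl
  have hΨ2 : ∀ z i, (Ψ z).2 i = b.repr z i.succ := fun z i => rfl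
  have hin : ∀ z, b.repr z 0 = ∑ j, u j * z j := by
    intro z
    rw [b.repr_apply_apply, hb0, PiLp.inner_apply]
    simp [mul_comm]
  let S : Set (ℝ × (Fin m → ℝ)) := {p | p.1 ^ 2 + ∑ i, p.2 i ^ 2 ≤ 1}
  have hS : MeasurableSet S := (isClosed_le (by fun_prop) (by fun_prop)).measurableSet
  have hpre : Ψ ⁻¹' S = Metric.closedBall (0 : EuclideanSpace ℝ (Fin (m + 1))) 1 := by
    ext z
    rw [mem_closedBall_zero_iff, ← b.repr.norm_map z, EuclideanSpace.norm_eq, Real.sqrt_le_iff, one_pow, and_iff_right zero_le_one,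
      Fin.sum_univ_succ]
    simp only [Real.norm_eq_abs, sq_abs]
    rfl
  have hfun : ∀ z, F (∑ j, u j * z j) = (fun p : ℝ × (Fin m → ℝ) => F p.1) (Ψ z) := by
    intro z; rw [← hin]; rfl
  have hint : IntegrableOn (fun p : ℝ × (Fin m → ℝ) => F p.1) S volume := by
    rw [← hΨ.integrableOn_comp_preimage Ψ.measurableEmbedding, hpre]
    have : (fun p : ℝ × (Fin m → ℝ) => F p.1) ∘ Ψ
      = fun z : EuclideanSpace ℝ (Fin (m + 1)) => F (∑ j, u j * z j) := by
      funext z; exact (hfun z).symm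
    rw [this]
    exact (Continuous.continuousOn (by fun_prop)).integrableOn_compact (isCompact_closedBall _ _)
  simp_rw [hfun]
  rw [← hpre, hΨ.setIntegral_preimage_emb Ψ.measurableEmbedding
    (fun p : ℝ × (Fin m → ℝ) => F p.1) S, ← integral_indicator hS]
  rw [Measure.volume_eq_prod, integral_prod _ (by
    rw [← Measure.volume_eq_prod]; exact (integrable_indicator_iff hS).2 hint)]
  congr 1
  funext t
  have hSt : MeasurableSet {w : Fin m → ℝ | t ^ 2 + ∑ i, w i ^ 2 ≤ 1} :=
    (isClosed_le (by fun_prop) (by fun_prop)).measurableSet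
  have : (fun w : Fin m → ℝ => S.indicator (fun p : ℝ × (Fin m → ℝ) => F p.1) (t, w)) =
      ({w : Fin m → ℝ | t ^ 2 + ∑ i, w i ^ 2 ≤ 1}).indicator (fun _ => F t) := by
    funext w
    simp only [Set.indicator, S, Set.mem_setOf_eq]
  rw [this, integral_indicator hSt, setIntegral_const]
  split_ifs with ht
  · rw [slice_vol_s16 m hm t ht, smul_eq_mul, mul_comm]
  · have : {w : Fin m → ℝ | t ^ 2 + ∑ i, w i ^ 2 ≤ 1} = ∅ := by
      ext w
      simp only [Set.mem_setOf_eq, Set.mem_empty_iff_false, iff_false]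
      have : 0 ≤ ∑ i, w i ^ 2 := Finset.sum_nonneg fun i _ => sq_nonneg _
      intro h; exact ht (by linarith)
    rw [this]; simp

lemma cap_int (m : ℕ) (hm : 1 ≤ m) (u : EuclideanSpace ℝ (Fin (m + 1))) (hu : ‖u‖ = 1)
    (ε : ℝ) (hε : 0 < ε) (hε' : ε < 1 / 2) :
    ∫ z in Metric.closedBall (0 : EuclideanSpace ℝ (Fin (m + 1))) 1,
        (relu ((∑ j, u j * z j) - (1 - ε ^ 2))) ^ 2 =
      (π ^ ((m : ℝ) / 2) / Real.Gamma ((m : ℝ) / 2 + 1)) * ε ^ (m + 6) *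
        ∫ s in (0 : ℝ)..1, (1 - s) ^ 2 * (s * (2 - ε ^ 2 * s)) ^ ((m : ℝ) / 2) := by
  have he : ε ^ 2 < 1 / 4 := by nlinarith
  have he0 : 0 < ε ^ 2 := by positivity
  rw [slice_int m hm u hu (fun t => (relu (t - (1 - ε ^ 2))) ^ 2) (by unfold relu; fun_prop)]
  set V := π ^ ((m : ℝ) / 2) / Real.Gamma ((m : ℝ) / 2 + 1) with hV
  let f : ℝ → ℝ := fun t => (t - (1 - ε ^ 2)) ^ 2 * (V * (1 - t ^ 2) ^ ((m : ℝ) / 2))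
  have h1 : (fun t : ℝ => if t ^ 2 ≤ 1 then (relu (t - (1 - ε ^ 2))) ^ 2 *
      (V * (1 - t ^ 2) ^ ((m : ℝ) / 2)) else 0) = (Set.Ioc (1 - ε ^ 2) 1).indicator f := by
    funext t
    by_cases ht : 1 - ε ^ 2 < t
    · have hr : relu (t - (1 - ε ^ 2)) = t - (1 - ε ^ 2) := max_eq_left (by linarith)
      have hiff : t ^ 2 ≤ 1 ↔ t ≤ 1 := by constructor <;> intro h <;> nlinarith
      simp only [Set.indicator, Set.mem_Ioc, ht, true_and, hr, hiff, f]
    · have hr : relu (t - (1 - ε ^ 2)) = 0 := max_eq_right (by linarith)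
      simp [Set.indicator, ht, hr]
  rw [h1, integral_indicator measurableSet_Ioc,
    ← intervalIntegral.integral_of_le (by linarith)]
  have h2 := intervalIntegral.integral_comp_sub_mul (a := 0) (b := 1) f he0.ne' 1
  simp only [mul_one, mul_zero, sub_zero, smul_eq_mul] at h2
  have h3 : ∫ t in (1 - ε ^ 2)..1, f t = ε ^ 2 * ∫ s in (0 : ℝ)..1, f (1 - ε ^ 2 * s) := by
    rw [h2]; field_simp
  rw [h3, ← intervalIntegral.integral_const_mul, ← intervalIntegral.integral_const_mul]
  apply intervalIntegral.integral_congr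
  intro s hs
  rw [Set.uIcc_of_le zero_le_one] at hs
  obtain ⟨hs0, hs1⟩ := hs
  simp only [f]
  have h4 : 1 - (1 - ε ^ 2 * s) ^ 2 = ε ^ 2 * (s * (2 - ε ^ 2 * s)) := by ring
  have h5 : (ε ^ 2) ^ ((m : ℝ) / 2) = ε ^ m := by
    rw [← Real.rpow_natCast, ← Real.rpow_natCast, ← Real.rpow_mul hε.le]
    congr 1; push_cast; ring
  rw [h4, Real.mul_rpow he0.le (mul_nonneg hs0 (by nlinarith)), h5]
  ring

/-- **`L²` norm of a boundary ReLU atom (Lemma `lemma:capReLU_L2_norm`).** -/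
theorem relu_atom_L2_norm_bounds
    (d : ℕ) (hd : 2 ≤ d) (u : Euc d) (hu : ‖u‖ = 1)
    (ε : ℝ) (hε : 0 < ε) (hε' : ε < 1 / 2) :
    (π ^ (((d : ℝ) - 1) / 2) / Real.Gamma (((d : ℝ) + 1) / 2)) * (7 / 4) ^ (((d : ℝ) - 1) / 2) *
        (∫ s in (0 : ℝ)..1, (1 - s) ^ 2 * s ^ (((d : ℝ) - 1) / 2)) * ε ^ (d + 5) ≤
      (∫ z in Metric.closedBall (0 : Euc d) 1, (relu ((∑ j, u j * z j) - (1 - ε ^ 2))) ^ 2) ∧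
    (∫ z in Metric.closedBall (0 : Euc d) 1, (relu ((∑ j, u j * z j) - (1 - ε ^ 2))) ^ 2) ≤
      (π ^ (((d : ℝ) - 1) / 2) / Real.Gamma (((d : ℝ) + 1) / 2)) * 2 ^ (((d : ℝ) - 1) / 2) *
        (∫ s in (0 : ℝ)..1, (1 - s) ^ 2 * s ^ (((d : ℝ) - 1) / 2)) * ε ^ (d + 5) := by
  obtain ⟨m, rfl⟩ : ∃ m, d = m + 1 := ⟨d - 1, by omega⟩
  have hm : 1 ≤ m := by omega
  have he : ε ^ 2 < 1 / 4 := by nlinarith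
  have he0 : 0 < ε ^ 2 := by positivity
  have e1 : (((m + 1 : ℕ) : ℝ) - 1) / 2 = (m : ℝ) / 2 := by push_cast; ring
  have e2 : (((m + 1 : ℕ) : ℝ) + 1) / 2 = (m : ℝ) / 2 + 1 := by push_cast; ring
  have hp : 0 ≤ (m : ℝ) / 2 := by positivity
  rw [e1, e2, cap_int m hm u hu ε hε hε']
  set V := π ^ ((m : ℝ) / 2) / Real.Gamma ((m : ℝ) / 2 + 1) with hV
  have hV0 : 0 ≤ V := by
    have hG : 0 < Real.Gamma ((m : ℝ) / 2 + 1) := Real.Gamma_pos_of_pos (by positivity)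
    positivity
  have hc : ∀ c : ℝ, V * c ^ ((m : ℝ) / 2) *
      (∫ s in (0 : ℝ)..1, (1 - s) ^ 2 * s ^ ((m : ℝ) / 2)) * ε ^ (m + 1 + 5) =
      V * ε ^ (m + 6) * ∫ s in (0 : ℝ)..1, c ^ ((m : ℝ) / 2) * ((1 - s) ^ 2 * s ^ ((m : ℝ) / 2)) := by
    intro c
    rw [intervalIntegral.integral_const_mul]; ring
  have hi1 : ∀ c : ℝ, IntervalIntegrable
      (fun s : ℝ => c ^ ((m : ℝ) / 2) * ((1 - s) ^ 2 * s ^ ((m : ℝ) / 2))) volume 0 1 := by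
    intro c
    have := Real.continuous_rpow_const hp
    exact Continuous.intervalIntegrable (by fun_prop) _ _
  have hi2 : IntervalIntegrable
      (fun s : ℝ => (1 - s) ^ 2 * (s * (2 - ε ^ 2 * s)) ^ ((m : ℝ) / 2)) volume 0 1 := by
    have h := (Real.continuous_rpow_const hp).comp
      (show Continuous fun s : ℝ => s * (2 - ε ^ 2 * s) by fun_prop)
    exact Continuous.intervalIntegrable ((by fun_prop : Continuous fun s : ℝ => (1 - s) ^ 2).mul h) _ _
  rw [hc, hc]
  constructor
  · refine mul_le_mul_of_nonneg_left ?_ (by positivity)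
    refine intervalIntegral.integral_mono_on zero_le_one (hi1 _) hi2 ?_
    rintro s ⟨hs0, hs1⟩
    rw [mul_left_comm, ← Real.mul_rpow (by norm_num) hs0]
    refine mul_le_mul_of_nonneg_left ?_ (sq_nonneg _)
    refine Real.rpow_le_rpow (by positivity) ?_ hp
    rw [mul_comm]
    exact mul_le_mul_of_nonneg_left (by nlinarith) hs0
  · refine mul_le_mul_of_nonneg_left ?_ (by positivity)
    refine intervalIntegral.integral_mono_on zero_le_one hi2 (hi1 _) ?_
    rintro s ⟨hs0, hs1⟩
    rw [mul_left_comm, ← Real.mul_rpow (by norm_num) hs0]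
    refine mul_le_mul_of_nonneg_left ?_ (sq_nonneg _)
    refine Real.rpow_le_rpow (mul_nonneg hs0 (by nlinarith)) ?_ hp
    rw [mul_comm 2 s]
    exact mul_le_mul_of_nonneg_left (by nlinarith) hs0


end
end

section
/- Let d ≥ 2. There exist constants κ_d > 0, c_d > 0, c*_d > 0 and an integer n₀, all depending only on d, such that for every n ≥ n₀ the following holds with ε = (c*_d/n)^{1/(d+1)}: there exist an integer M ≥ 2, sign vectors, and unit vectors u_1,…,u_K ∈ S^{d−1} yielding functions f_1,…,f_M : B_1^d → ℝ, each of the form f_j(x) = Σ_{i=1}^K ξ_i^{(j)} ε^{−2} max(u_iᵀx − (1−ε²), 0) with ξ^{(j)} ∈ {−1,1}^K, satisfying ‖f_j‖_{L∞(B_1^d)} ≤ 1 and |f_j|_{V_g} ≤ 1 for all j, such that: (i) ‖f_j − f_k‖²_{L²(B_1^d)} ≥ c_d n^{−2/(d+1)} for all j ≠ k; and (ii) if x_1,…,x_n are i.i.d. Uniform(B_1^d), then with probability at least 1 − exp(−κ_d n^{(d−1)/(d+1)}) there exist indices j ≠ k with f_j(x_i) = f_k(x_i) for all i = 1,…,n.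 -/
open MeasureTheory Real Filter ProbabilityTheory
open scoped ENNReal Classical BigOperators

noncomputable section

lemma aux_code (K : ℕ) (hK : 0 < K) : ∃ C : Finset (Finset (Fin K)),
    (∀ s ∈ C, ∀ t ∈ C, s ≠ t → K ≤ 8 * (symmDiff s t).card) ∧ (4/3:ℝ)^K ≤ C.card := by
  let P : Finset (Finset (Finset (Fin K))) := Finset.univ.filter (fun C =>
    ∀ s ∈ C, ∀ t ∈ C, s ≠ t → K ≤ 8 * (symmDiff s t).card)
  have hP : P.Nonempty := ⟨∅, by simp [P]⟩
  obtain ⟨C, hC, hmax⟩ := Finset.exists_max_image P Finset.card hP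
  have hC' : ∀ s ∈ C, ∀ t ∈ C, s ≠ t → K ≤ 8 * (symmDiff s t).card := by simpa [P] using hC
  refine ⟨C, hC', ?_⟩
  let B : Finset (Finset (Fin K)) := Finset.univ.filter (fun s => 8 * s.card < K)
  have hcov : (Finset.univ : Finset (Finset (Fin K))) ⊆ C.biUnion (fun s => B.image (fun t => symmDiff s t)) := by
    intro t _
    by_contra hcon
    have hfar : ∀ s ∈ C, K ≤ 8 * (symmDiff s t).card := by
      intro s hs
      by_contra hlt
      apply hcon
      rw [Finset.mem_biUnion]
      refine ⟨s, hs, Finset.mem_image.2 ⟨symmDiff s t, ?_, by simp⟩⟩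
      simp only [B, Finset.mem_filter, Finset.mem_univ, true_and]; omega
    have htC : t ∉ C := by
      intro ht
      have := hfar t ht
      simp at this; omega
    have hins : insert t C ∈ P := by
      simp only [P, Finset.mem_filter, Finset.mem_univ, true_and]
      intro a ha b hb hab
      rw [Finset.mem_insert] at ha hb
      rcases ha with rfl | ha <;> rcases hb with rfl | hb
      · exact absurd rfl hab
      · rw [symmDiff_comm]; exact hfar b hb
      · exact hfar a ha
      · exact hC' a ha b hb hab
    have := hmax _ hins
    rw [Finset.card_insert_of_notMem htC] at this
    omega
  have hcard : 2 ^ K ≤ C.card * B.card := by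
    have h1 := Finset.card_le_card hcov
    have h2 : (C.biUnion (fun s => B.image (fun t => symmDiff s t))).card ≤ C.card * B.card :=
      Finset.card_biUnion_le_card_mul _ _ _ (fun s _ => Finset.card_image_le)
    simp at h1
    omega
  have hB : (B.card : ℝ) ≤ (3/2:ℝ)^K := by
    have h1 := Fintype.sum_pow_mul_eq_add_pow (Fin K) ((5/6:ℝ)^8) 1
    simp only [one_pow, mul_one, Fintype.card_fin] at h1
    have h2 : (B.card : ℝ) * (5/6:ℝ)^K ≤ ((5/6:ℝ)^8 + 1)^K := by
      rw [← h1]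
      calc (B.card : ℝ) * (5/6:ℝ)^K = ∑ s ∈ B, (5/6:ℝ)^K := by simp
        _ ≤ ∑ s ∈ B, ((5/6:ℝ)^8)^s.card := by
          apply Finset.sum_le_sum
          intro s hs
          rw [← pow_mul]
          apply pow_le_pow_of_le_one (by norm_num) (by norm_num)
          simp only [B, Finset.mem_filter, Finset.mem_univ, true_and] at hs
          omega
        _ ≤ _ := Finset.sum_le_sum_of_subset_of_nonneg (Finset.subset_univ _)
            (fun _ _ _ => by positivity)
    have h3 : ((5/6:ℝ)^8 + 1)^K ≤ (5/4:ℝ)^K := by gcongr; norm_num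
    have h4 : (5/4:ℝ)^K = (3/2:ℝ)^K * (5/6:ℝ)^K := by rw [← mul_pow]; norm_num
    have h5 : (0:ℝ) < (5/6:ℝ)^K := by positivity
    exact le_of_mul_le_mul_right (by linarith) h5
  have hcard' : (2:ℝ)^K ≤ C.card * B.card := by exact_mod_cast hcard
  have h6 : (2:ℝ)^K ≤ C.card * (3/2:ℝ)^K := hcard'.trans (by gcongr)
  have h7 : (2:ℝ)^K = (4/3:ℝ)^K * (3/2:ℝ)^K := by rw [← mul_pow]; norm_num
  rw [h7] at h6
  exact le_of_mul_le_mul_right h6 (by positivity)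

lemma aux_pts (d' m : ℕ) (ε : ℝ) (hε : 0 < ε) (h : 9 * d' * ε^2 * (m:ℝ)^2 ≤ 1) :
    ∃ u : Fin (m^d') → Euc (d'+1), (∀ i, ‖u i‖ = 1) ∧
      ∀ i j, i ≠ j → 9 * ε^2 ≤ ‖u i - u j‖^2 := by
  let y : (Fin d' → Fin m) → Fin d' → ℝ := fun k l => 3 * ε * ((k l : ℕ) : ℝ)
  let v : (Fin d' → Fin m) → Euc (d'+1) := fun k =>
    WithLp.toLp 2 (Fin.cons (Real.sqrt (1 - ∑ l, y k l ^ 2)) (y k))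
  have hv0 : ∀ k, v k 0 = Real.sqrt (1 - ∑ l, y k l ^ 2) := fun k => rfl
  have hvs : ∀ k l, v k (Fin.succ l) = y k l := fun k l => rfl
  have hsum : ∀ k, ∑ l, y k l ^ 2 ≤ 1 := by
    intro k
    calc ∑ l, y k l ^ 2 ≤ ∑ l : Fin d', 9 * ε^2 * (m:ℝ)^2 := by
          apply Finset.sum_le_sum
          intro l _
          have : ((k l : ℕ) : ℝ) ≤ m := by exact_mod_cast (k l).2.le
          have h0 : (0:ℝ) ≤ ((k l : ℕ) : ℝ) := by positivity
          have : ((k l : ℕ) : ℝ)^2 ≤ (m:ℝ)^2 := by gcongr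
          simp only [y]
          nlinarith [mul_le_mul_of_nonneg_left this (by positivity : 0 ≤ 9 * ε^2)]
      _ ≤ 1 := by simp; linarith
  refine ⟨fun i => v (finFunctionFinEquiv.symm i), ?_, ?_⟩
  · intro i
    set k := finFunctionFinEquiv.symm i
    have : ‖v k‖^2 = 1 := by
      rw [EuclideanSpace.norm_sq_eq, Fin.sum_univ_succ]
      simp only [hv0, hvs, Real.norm_eq_abs, sq_abs]
      rw [Real.sq_sqrt (by linarith [hsum k])]; ring
    have h0 := norm_nonneg (v k)
    nlinarith
  · intro i j hij
    have hk : finFunctionFinEquiv.symm i ≠ finFunctionFinEquiv.symm j := by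
      simpa using hij
    show 9 * ε^2 ≤ ‖v (finFunctionFinEquiv.symm i) - v (finFunctionFinEquiv.symm j)‖^2
    generalize finFunctionFinEquiv.symm i = k at *
    generalize finFunctionFinEquiv.symm j = k' at *
    obtain ⟨l, hl⟩ := Function.ne_iff.1 hk
    rw [EuclideanSpace.norm_sq_eq]
    have h1 := Finset.single_le_sum (f := fun a => ‖(v k - v k') a‖^2)
      (fun a _ => by positivity) (Finset.mem_univ (Fin.succ l))
    refine le_trans ?_ h1
    simp only [PiLp.sub_apply, hvs, Real.norm_eq_abs, sq_abs, y]
    have h2 : (1:ℝ) ≤ (((k l : ℕ) : ℝ) - ((k' l : ℕ) : ℝ))^2 := by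
      have : ((k l : ℕ) : ℤ) - ((k' l : ℕ) : ℤ) ≠ 0 := by
        intro h; apply hl; ext; omega
      have h3 : (1:ℤ) ≤ (((k l : ℕ) : ℤ) - ((k' l : ℕ) : ℤ))^2 := by
        have := sq_pos_of_ne_zero this
        omega
      exact_mod_cast h3
    nlinarith [mul_le_mul_of_nonneg_left h2 (by positivity : 0 ≤ 9 * ε^2)]

lemma aux_inner {d : ℕ} (u z : Euc d) : ∑ l, u l * z l = inner ℝ u z := by
  simp [PiLp.inner_apply, mul_comm]

lemma aux_disj {d : ℕ} (u u' z : Euc d) (ε : ℝ) (hu : ‖u‖ = 1) (hu' : ‖u'‖ = 1)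
    (hz : ‖z‖ ≤ 1) (hsep : 9 * ε^2 ≤ ‖u - u'‖^2) (h1 : 1 - ε^2 < ∑ l, u l * z l)
    (h2 : 1 - ε^2 < ∑ l, u' l * z l) : False := by
  rw [aux_inner] at h1 h2
  have e1 := norm_sub_sq_real u z
  have e2 := norm_sub_sq_real u' z
  have hz2 : ‖z‖^2 ≤ 1 := by nlinarith [norm_nonneg z]
  have tri : ‖u - u'‖ ≤ ‖u - z‖ + ‖u' - z‖ := by
    have := norm_sub_le (u - z) (u' - z); simpa using this
  rw [hu] at e1; rw [hu'] at e2
  have h3 : ‖u - u'‖^2 ≤ 2 * ‖u-z‖^2 + 2 * ‖u'-z‖^2 := by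
    nlinarith [norm_nonneg (u-u'), sq_nonneg (‖u-z‖ - ‖u'-z‖), norm_nonneg (u-z), norm_nonneg (u'-z)]
  nlinarith [sq_nonneg ε]

def icap {d : ℕ} (ε : ℝ) (u : Euc d) : Set (Euc d) :=
  {z | ‖z‖ ≤ 1 ∧ 1 - ε^2/2 ≤ ∑ l, u l * z l}

lemma icap_meas {d : ℕ} (ε : ℝ) (u : Euc d) : MeasurableSet (icap ε u) := by
  apply IsClosed.measurableSet
  apply IsClosed.inter
  · exact isClosed_le continuous_norm continuous_const
  · have : Continuous (fun z : Euc d => ∑ l, u l * z l) := by fun_prop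
    exact isClosed_le continuous_const this

lemma icap_fin {d : ℕ} (ε : ℝ) (u : Euc d) : volume (icap ε u) ≠ ⊤ := by
  have h : icap ε u ⊆ Metric.closedBall (0 : Euc d) 1 := fun z hz => by simpa using hz.1
  exact ((measure_mono h).trans_lt (isCompact_closedBall _ _).measure_lt_top).ne

lemma icap_rot {d : ℕ} (ε : ℝ) (u v : Euc d) (h : ‖u‖ = ‖v‖) :
    volume (icap ε u) = volume (icap ε v) := by
  let T := (ℝ ∙ (u - v))ᗮ.reflection
  have hT : T u = v := Submodule.reflection_sub h
  have hp := T.measurePreserving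
  rw [← hp.measure_preimage (icap_meas ε v).nullMeasurableSet]
  congr 1
  ext z
  simp only [icap, Set.mem_ofPred_eq, Set.mem_preimage, aux_inner, ← hT, T.norm_map,
    T.inner_map_map]

lemma icap_vol {d' : ℕ} (ε : ℝ) (hε : 0 < ε) (hε1 : ε ≤ 1) (u : Euc (d'+1)) (hu : ‖u‖ = 1) :
    (ε^2/4) * (ε/(d'+1))^d' ≤ volume.real (icap ε u) := by
  let e : Euc (d'+1) := EuclideanSpace.single 0 1
  have he : ‖e‖ = 1 := by simp [e]
  rw [Measure.real, icap_rot ε u e (by rw [hu, he])]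
  set s : ℝ := ε / (2 * (d'+1)) with hs
  let S : Set (Fin (d'+1) → ℝ) := Set.Icc (Fin.cons (1 - ε^2/2) (fun _ => -s)) (Fin.cons (1 - ε^2/4) (fun _ => s))
  have hvol : volume S = ENNReal.ofReal ((ε^2/4) * (ε/(d'+1))^d') := by
    rw [Real.volume_Icc_pi, Fin.prod_univ_succ, ENNReal.ofReal_mul (by positivity),
      ENNReal.ofReal_pow (by positivity)]
    simp only [Fin.cons_zero, Fin.cons_succ, Finset.prod_const, Finset.card_univ, Fintype.card_fin]
    congr 2
    · ring
    · congr 1; rw [hs]; field_simp; ring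
  have hp := PiLp.volume_preserving_ofLp (Fin (d'+1))
  have hsub : (@WithLp.ofLp 2 (Fin (d'+1) → ℝ)) ⁻¹' S ⊆ icap ε e := by
    intro z hz
    simp only [Set.mem_preimage, S, Set.mem_Icc, Pi.le_def] at hz
    have h0 := hz.1 0
    have h0' := hz.2 0
    have h1 : ∀ l : Fin d', z (Fin.succ l)^2 ≤ s^2 := by
      intro l
      have a := hz.1 (Fin.succ l)
      have b := hz.2 (Fin.succ l)
      simp only [Fin.cons_succ] at a b
      exact sq_le_sq' a b
    simp only [Fin.cons_zero] at h0 h0'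
    refine ⟨?_, ?_⟩
    · have : ‖z‖^2 ≤ 1 := by
        rw [EuclideanSpace.norm_sq_eq, Fin.sum_univ_succ]
        simp only [Real.norm_eq_abs, sq_abs]
        have h2 : ∑ l : Fin d', z (Fin.succ l)^2 ≤ d' * s^2 := by
          calc _ ≤ ∑ l : Fin d', s^2 := Finset.sum_le_sum (fun l _ => h1 l)
            _ = _ := by simp
        have h3 : d' * s^2 ≤ ε^2/4 := by
          have hd : (0:ℝ) ≤ d' := by positivity
          rw [hs, div_pow, mul_div_assoc', div_le_div_iff₀ (by positivity) (by norm_num)]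
          nlinarith [mul_nonneg (sq_nonneg ε) (by nlinarith : (0:ℝ) ≤ ((d':ℝ)+1)^2 - d')]
        have h4 : ε^2 ≤ 1 := by nlinarith
        have h5 : z 0 ^2 ≤ (1 - ε^2/4)^2 := by
          apply sq_le_sq' <;> nlinarith
        nlinarith
      nlinarith [norm_nonneg z]
    · simp [e]; simpa using h0
  have hm : volume S ≤ volume (icap ε e) := by
    rw [← hp.measure_preimage measurableSet_Icc.nullMeasurableSet]
    exact measure_mono hsub
  rw [hvol] at hm
  exact (ENNReal.ofReal_le_iff_le_toReal (icap_fin ε e)).1 hm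

lemma aux_shell (d : ℕ) (ε : ℝ) (hε1 : ε^2 ≤ 1) :
    (uniformBall d).real (Metric.closedBall 0 (1 - ε^2))ᶜ ≤ d * ε^2 := by
  rw [probReal_compl_eq_one_sub measurableSet_closedBall]
  have h : (uniformBall d).real (Metric.closedBall 0 (1 - ε^2)) = (1-ε^2)^d := by
    rw [Measure.real, uniformBall, Measure.smul_apply, Measure.restrict_apply measurableSet_closedBall,
      Set.inter_eq_left.2 (Metric.closedBall_subset_closedBall (by nlinarith)),
      Measure.addHaar_closedBall' _ _ (by linarith : 0 ≤ 1 - ε^2), smul_eq_mul, mul_comm, mul_assoc,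
      ENNReal.mul_inv_cancel]
    · simp; exact pow_nonneg (by linarith) _
    · exact (Metric.measure_closedBall_pos volume (0 : Euc d) one_pos).ne'
    · exact (isCompact_closedBall _ _).measure_lt_top.ne
  rw [h]
  have := one_add_mul_le_pow (a := -ε^2) (by linarith) d
  rw [← sub_eq_add_neg] at this
  nlinarith

def cnt {E : Type*} {n : ℕ} (G : Set E) (ω : Fin n → E) : ℕ :=
  (Finset.univ.filter (fun l => ω l ∈ G)).card

lemma aux_chernoff {E : Type*} [MeasurableSpace E] (μ : Measure E) [IsProbabilityMeasure μ]
    (n : ℕ) (G : Set E) (hG : MeasurableSet G) (p a : ℝ) (hp : μ.real G ≤ p) :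
    (Measure.pi (fun _ : Fin n => μ)).real
      {ω | a ≤ (cnt G ω : ℝ)} ≤ Real.exp (2 * n * p - a) := by
  let h : E → ℝ := fun x => 1 + G.indicator (fun _ => Real.exp 1 - 1) x
  have he : 1 ≤ Real.exp 1 := by have := Real.add_one_le_exp (1:ℝ); linarith
  have he2 : Real.exp 1 ≤ 3 := by have := Real.exp_one_lt_d9; linarith
  have hh : ∀ x, h x = if x ∈ G then Real.exp 1 else 1 := by
    intro x; by_cases hx : x ∈ G <;> simp [h, hx]
  have hint : Integrable h μ := (integrable_const _).add ((integrable_const _).indicator hG)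
  have hintegral : ∫ x, h x ∂μ = 1 + (Real.exp 1 - 1) * μ.real G := by
    simp only [h]
    rw [integral_add (integrable_const _) ((integrable_const _).indicator hG),
      integral_indicator_const _ hG]
    simp [mul_comm]
  have hprod : ∀ ω : Fin n → E, ∏ l, h (ω l) = Real.exp (cnt G ω) := by
    intro ω
    unfold cnt
    simp only [hh, Finset.prod_ite, Finset.prod_const, one_pow, mul_one]
    rw [← Real.exp_nat_mul, mul_one]
  have hI : Integrable (fun ω : Fin n → E => ∏ l, h (ω l)) (Measure.pi (fun _ : Fin n => μ)) :=
    Integrable.fintype_prod (fun _ => hint)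
  have hM := mul_meas_ge_le_integral_of_nonneg (μ := Measure.pi (fun _ : Fin n => μ))
    (f := fun ω : Fin n → E => ∏ l, h (ω l))
    (Eventually.of_forall (fun ω => by simp only [hprod]; positivity)) hI (Real.exp a)
  rw [integral_fintype_prod_eq_pow, hintegral, Fintype.card_fin] at hM
  simp only [hprod, Real.exp_le_exp] at hM
  have hb : (1 + (Real.exp 1 - 1) * μ.real G)^n ≤ Real.exp (2 * n * p) := by
    have h0 : 0 ≤ μ.real G := measureReal_nonneg
    calc _ ≤ (Real.exp (2*p))^n := by
          apply pow_le_pow_left₀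
          · nlinarith
          · have := Real.add_one_le_exp (2*p)
            nlinarith
      _ = _ := by rw [← Real.exp_nat_mul]; ring_nf
  rw [Real.exp_sub, le_div_iff₀ (Real.exp_pos _), mul_comm]
  exact hM.trans hb

lemma aux_relu_cont {d : ℕ} (x : Euc d) : Continuous (fun p : Euc d × ℝ => relu ((∑ j, p.1 j * x j) - p.2)) := by
  unfold relu; fun_prop

def dsum {d K : ℕ} (a t : ℝ) (u : Fin K → Euc d) (s : Finset (Fin K)) : Measure (Euc d × ℝ) :=
  ∑ i ∈ s, ENNReal.ofReal a • Measure.dirac (u i, t)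

lemma dsum_apply {d K : ℕ} (a t : ℝ) (u : Fin K → Euc d) (s : Finset (Fin K)) (S : Set (Euc d × ℝ))
    (hS : ∀ i ∈ s, (u i, t) ∉ S) (hm : MeasurableSet S) : dsum a t u s S = 0 := by
  simp only [dsum, Measure.finsetSum_apply, Measure.smul_apply, Measure.dirac_apply' _ hm]
  apply Finset.sum_eq_zero
  intro i hi
  simp [hS i hi]

lemma dsum_integral {d K : ℕ} (a t : ℝ) (ha : 0 ≤ a) (u : Fin K → Euc d) (s : Finset (Fin K))
    (f : Euc d × ℝ → ℝ) :
    ∫ p, f p ∂(dsum a t u s) = ∑ i ∈ s, a * f (u i, t) := by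
  rw [dsum, integral_finsetSum_measure]
  · simp [ENNReal.toReal_ofReal ha]
  · intro i _
    exact (integrable_dirac (by simp)).smul_measure (by simp)

lemma aux_Vg {d K : ℕ} (ε : ℝ) (hε : 0 < ε) (hε1 : ε ≤ 1) (u : Fin K → Euc d) (hu : ∀ i, ‖u i‖ = 1)
    (hinj : Function.Injective u) (ξ : Fin K → ℝ) (hξ : ∀ i, ξ i = 1 ∨ ξ i = -1)
    (hK : (K:ℝ) * ε ^ (2*d+2) ≤ 1) :
    VgSeminorm d 1 (gPow d) (fun z => ∑ i, ξ i * (ε ^ 2)⁻¹ * relu ((∑ l, u i l * z l) - (1 - ε ^ 2))) ≤ 1 := by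
  set a : ℝ := (ε^2)⁻¹ with ha
  have ha0 : 0 ≤ a := by positivity
  set t : ℝ := 1 - ε^2 with ht
  have hε2 : ε^2 ≤ 1 := by nlinarith
  have hε20 : 0 < ε^2 := by positivity
  let P : Finset (Fin K) := Finset.univ.filter (fun i => ξ i = 1)
  have hfin : ∀ s, IsFiniteMeasure (dsum a t u s) := by
    intro s
    unfold dsum
    have : ∀ i ∈ s, IsFiniteMeasure (ENNReal.ofReal a • Measure.dirac (u i, t)) := by
      intro i _
      exact Measure.smul_finite _ (by simp)
    constructor
    simp [Measure.finsetSum_apply]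
    exact ENNReal.mul_lt_top (by simp) (by simp)
  have hsing : dsum a t u P ⟂ₘ dsum a t u Pᶜ := by
    let S : Set (Euc d × ℝ) := (fun i => (u i, t)) '' (Pᶜ : Finset (Fin K))
    have hS : MeasurableSet S := ((Finset.finite_toSet _).image _).measurableSet
    refine ⟨S, hS, ?_, ?_⟩
    · apply dsum_apply _ _ _ _ _ _ hS
      rintro i hi ⟨j, hj, hij⟩
      simp only [Prod.mk.injEq, and_true] at hij
      have := hinj hij
      subst this
      simp at hj
      exact hj hi
    · apply dsum_apply _ _ _ _ _ _ hS.compl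
      intro i hi
      simp only [Set.mem_compl_iff, not_not]
      exact ⟨i, hi, rfl⟩
  have := hfin P
  have := hfin Pᶜ
  let J : JordanDecomposition (Euc d × ℝ) := ⟨dsum a t u P, dsum a t u Pᶜ, hsing⟩
  have hJ : J.toSignedMeasure.toJordanDecomposition = J :=
    JordanDecomposition.toJordanDecomposition_toSignedMeasure J
  have hTV : J.toSignedMeasure.totalVariation = dsum a t u P + dsum a t u Pᶜ := by
    rw [SignedMeasure.totalVariation, hJ]
  have hTV2 : J.toSignedMeasure.totalVariation = dsum a t u Finset.univ := by
    rw [hTV, dsum, dsum, dsum, Finset.sum_add_sum_compl]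
  have hmem : ∫⁻ p, ENNReal.ofReal (gPow d p) ∂J.toSignedMeasure.totalVariation ≤ 1 := by
    rw [hTV2, dsum, lintegral_finsetSum_measure]
    have hg : Measurable (fun p : Euc d × ℝ => ENNReal.ofReal (gPow d p)) := by
      apply Measurable.ennreal_ofReal
      unfold gPow
      apply Measurable.ite
      · exact measurableSet_le (by fun_prop) (by fun_prop)
      · fun_prop
      · fun_prop
    simp only [lintegral_smul_measure, lintegral_dirac' _ hg, smul_eq_mul]
    have hgv : ∀ i, gPow d (u i, t) = (ε^2)^(d+2) := by
      intro i
      have : |t| = t := abs_of_nonneg (by linarith)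
      simp only [gPow, this]
      rw [if_pos (by linarith)]; congr 1; rw [ht]; ring
    simp only [hgv, Finset.sum_const, Finset.card_univ, Fintype.card_fin, nsmul_eq_mul]
    rw [← ENNReal.ofReal_mul ha0, ← ENNReal.ofReal_natCast, ← ENNReal.ofReal_mul (by positivity),
      ← ENNReal.ofReal_one]
    apply ENNReal.ofReal_le_ofReal
    have : a * (ε^2)^(d+2) = ε^(2*d+2) := by
      rw [ha, ← pow_mul, show 2*(d+2) = 2 + (2*d+2) by ring, pow_add]
      field_simp
    rw [this]; exact hK
  refine le_trans (sInf_le ⟨J.toSignedMeasure, 0, 0, ?_, ?_, rfl⟩) hmem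
  · rw [hTV2]
    apply dsum_apply
    · intro i _
      simp only [Set.mem_compl_iff, not_not]
      refine ⟨by simp [hu i], ?_, ?_⟩ <;> simp only [] <;> linarith
    · exact (Metric.isClosed_sphere.prod isClosed_Icc).measurableSet.compl
  · intro x _
    rw [hJ]
    show _ = ∫ p, _ ∂(dsum a t u P) - ∫ p, _ ∂(dsum a t u Pᶜ) + _ + _
    rw [dsum_integral a t ha0, dsum_integral a t ha0]
    simp only [PiLp.zero_apply, zero_mul, Finset.sum_const_zero, add_zero]
    rw [← Finset.sum_add_sum_compl P, sub_eq_add_neg, ← Finset.sum_neg_distrib]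
    congr 1
    · apply Finset.sum_congr rfl
      intro i hi
      have : ξ i = 1 := by simpa [P] using hi
      rw [this]; ring
    · apply Finset.sum_congr rfl
      intro i hi
      have h1 : ξ i ≠ 1 := by simpa [P] using hi
      have : ξ i = -1 := (hξ i).resolve_left h1
      rw [this]; ring

def fF {d K : ℕ} (ε : ℝ) (u : Fin K → Euc d) (ξ : Fin K → ℝ) (z : Euc d) : ℝ :=
  ∑ i, ξ i * (ε ^ 2)⁻¹ * relu ((∑ l, u i l * z l) - (1 - ε ^ 2))

lemma fF_cont {d K : ℕ} (ε : ℝ) (u : Fin K → Euc d) (ξ : Fin K → ℝ) : Continuous (fF ε u ξ) := by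
  unfold fF relu; fun_prop

lemma fF_cap {d K : ℕ} (ε : ℝ) (u : Fin K → Euc d) (hu : ∀ i, ‖u i‖ = 1)
    (hsep : ∀ i j, i ≠ j → 9 * ε^2 ≤ ‖u i - u j‖^2) (ξ : Fin K → ℝ) (z : Euc d) (hz : ‖z‖ ≤ 1)
    (i : Fin K) (hi : 1 - ε^2 < ∑ l, u i l * z l) :
    fF ε u ξ z = ξ i * (ε ^ 2)⁻¹ * ((∑ l, u i l * z l) - (1 - ε ^ 2)) := by
  unfold fF
  rw [Finset.sum_eq_single i]
  · rw [relu, max_eq_left (by linarith)]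
  · intro j _ hji
    have : ∑ l, u j l * z l ≤ 1 - ε^2 := by
      by_contra h
      exact aux_disj (u j) (u i) z ε (hu j) (hu i) hz (hsep j i hji) (not_le.1 h) hi
    rw [relu, max_eq_right (by linarith), mul_zero]
  · simp

lemma fF_bound {d K : ℕ} (ε : ℝ) (hε : 0 < ε) (u : Fin K → Euc d) (hu : ∀ i, ‖u i‖ = 1)
    (hsep : ∀ i j, i ≠ j → 9 * ε^2 ≤ ‖u i - u j‖^2) (ξ : Fin K → ℝ)
    (hξ : ∀ i, ξ i = 1 ∨ ξ i = -1) (z : Euc d) (hz : ‖z‖ ≤ 1) : |fF ε u ξ z| ≤ 1 := by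
  by_cases h : ∃ i, 1 - ε^2 < ∑ l, u i l * z l
  · obtain ⟨i, hi⟩ := h
    rw [fF_cap ε u hu hsep ξ z hz i hi, abs_mul, abs_mul]
    have h1 : |ξ i| = 1 := by rcases hξ i with h | h <;> simp [h]
    have h2 : ∑ l, u i l * z l ≤ 1 := by
      rw [aux_inner]
      have := real_inner_le_norm (u i) z
      rw [hu i] at this; linarith
    rw [h1, one_mul, abs_of_pos (by positivity : 0 < (ε^2)⁻¹), abs_of_pos (by linarith),
      inv_mul_le_iff₀ (by positivity)]
    linarith
  · push Not at h
    have : fF ε u ξ z = 0 := by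
      unfold fF
      apply Finset.sum_eq_zero
      intro i _
      rw [relu, max_eq_right (by linarith [h i]), mul_zero]
    rw [this]; simp

def sg {K : ℕ} (s : Finset (Fin K)) (i : Fin K) : ℝ := if i ∈ s then 1 else -1

lemma sg_pm {K : ℕ} (s : Finset (Fin K)) (i : Fin K) : sg s i = 1 ∨ sg s i = -1 := by
  unfold sg; split_ifs <;> simp

lemma fF_L2 {d K : ℕ} (ε : ℝ) (hε : 0 < ε) (u : Fin K → Euc d) (hu : ∀ i, ‖u i‖ = 1)
    (hsep : ∀ i j, i ≠ j → 9 * ε^2 ≤ ‖u i - u j‖^2) (s t : Finset (Fin K)) (v : ℝ)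
    (hv : ∀ i, v ≤ volume.real (icap ε (u i))) :
    ((symmDiff s t).card : ℝ) * v ≤
      ∫ z in Metric.closedBall (0 : Euc d) 1, (fF ε u (sg s) z - fF ε u (sg t) z)^2 := by
  have hε2 : 0 < ε^2 := by positivity
  let U : Set (Euc d) := ⋃ i ∈ symmDiff s t, icap ε (u i)
  have hUm : MeasurableSet U := Finset.measurableSet_biUnion _ (fun i _ => icap_meas ε (u i))
  have hUsub : U ⊆ Metric.closedBall (0 : Euc d) 1 := by
    intro z hz
    simp only [U, Set.mem_iUnion] at hz
    obtain ⟨i, _, hz⟩ := hz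
    simpa using hz.1
  have hvolU : volume.real U = ∑ i ∈ symmDiff s t, volume.real (icap ε (u i)) := by
    apply measureReal_biUnion_finset
    · intro i _ j _ hij
      rw [Function.onFun, Set.disjoint_left]
      intro z hzi hzj
      exact aux_disj (u i) (u j) z ε (hu i) (hu j) hzi.1 (hsep i j hij)
        (by linarith [hzi.2]) (by linarith [hzj.2])
    · intro i _; exact icap_meas ε (u i)
    · intro i _; exact icap_fin ε (u i)
  have h1 : ((symmDiff s t).card : ℝ) * v ≤ volume.real U := by
    rw [hvolU, ← nsmul_eq_mul]
    exact Finset.card_nsmul_le_sum _ _ _ (fun i _ => hv i)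
  refine h1.trans ?_
  have hint : IntegrableOn (fun z => (fF ε u (sg s) z - fF ε u (sg t) z)^2)
      (Metric.closedBall (0 : Euc d) 1) volume :=
    (((fF_cont ε u _).sub (fF_cont ε u _)).pow 2).continuousOn.integrableOn_compact
      (isCompact_closedBall _ _)
  have hUfin : volume U ≠ ⊤ :=
    ((measure_mono hUsub).trans_lt (isCompact_closedBall _ _).measure_lt_top).ne
  calc volume.real U = ∫ z in U, (1:ℝ) := by simp
    _ ≤ ∫ z in U, (fF ε u (sg s) z - fF ε u (sg t) z)^2 := by
      apply setIntegral_mono_on _ (hint.mono_set hUsub) hUm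
      · intro z hz
        simp only [U, Set.mem_iUnion] at hz
        obtain ⟨i, hi, hz⟩ := hz
        have hlt : 1 - ε^2 < ∑ l, u i l * z l := by linarith [hz.2]
        rw [fF_cap ε u hu hsep _ z hz.1 i hlt, fF_cap ε u hu hsep _ z hz.1 i hlt]
        have hsq : (sg s i - sg t i)^2 = 4 := by
          rw [Finset.mem_symmDiff] at hi
          rcases hi with ⟨a, b⟩ | ⟨a, b⟩ <;> simp [sg, a, b] <;> norm_num
        have hge : 1/2 ≤ (ε^2)⁻¹ * ((∑ l, u i l * z l) - (1 - ε ^ 2)) := by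
          rw [inv_mul_eq_div, le_div_iff₀ hε2]; linarith [hz.2]
        set w := (ε^2)⁻¹ * ((∑ l, u i l * z l) - (1 - ε ^ 2)) with hw
        calc (1:ℝ) ≤ 4 * w^2 := by nlinarith
          _ = (sg s i - sg t i)^2 * w^2 := by rw [hsq]
          _ = _ := by rw [hw]; ring
      · exact integrableOn_const hUfin
    _ ≤ _ := by
      apply setIntegral_mono_set hint
      · exact Eventually.of_forall (fun z => sq_nonneg _)
      · exact hUsub.eventuallyLE

lemma fF_pigeon {d K n : ℕ} (ε : ℝ) (u : Fin K → Euc d) (hu : ∀ i, ‖u i‖ = 1)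
    (hsep : ∀ i j, i ≠ j → 9 * ε^2 ≤ ‖u i - u j‖^2) (C : Finset (Finset (Fin K)))
    (hC : (4/3:ℝ)^K ≤ C.card) (hK : 0 < K) (ω : Fin n → Euc d) (hω : ∀ l, ‖ω l‖ ≤ 1)
    (hN : (cnt (Metric.closedBall (0 : Euc d) (1 - ε^2))ᶜ ω : ℝ) < K/4) :
    ∃ s ∈ C, ∃ t ∈ C, s ≠ t ∧ ∀ l, fF ε u (sg s) (ω l) = fF ε u (sg t) (ω l) := by
  unfold cnt at hN
  generalize hG : (Metric.closedBall (0 : Euc d) (1 - ε^2))ᶜ = G at hN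
  set L := Finset.univ.filter (fun l => ω l ∈ G) with hL
  let O : Finset (Fin K) := L.biUnion (fun l => Finset.univ.filter (fun i => 1 - ε^2 < ∑ m, u i m * ω l m))
  have hO : O.card ≤ L.card := by
    have := Finset.card_biUnion_le_card_mul L
      (fun l => Finset.univ.filter (fun i => 1 - ε^2 < ∑ m, u i m * ω l m)) 1 ?_
    · simpa using this
    · intro l _
      rw [Finset.card_le_one]
      intro i hi j hj
      by_contra hij
      simp only [Finset.mem_filter, Finset.mem_univ, true_and] at hi hj
      exact aux_disj (u i) (u j) (ω l) ε (hu i) (hu j) (hω l) (hsep i j hij) hi hj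
  have hO4 : 4 * O.card < K := by
    have : (4:ℝ) * L.card < K := by linarith
    have : 4 * L.card < K := by exact_mod_cast this
    omega
  have hlt : O.powerset.card < C.card := by
    rw [Finset.card_powerset]
    have h1 : ((2:ℝ)^O.card)^4 < (C.card : ℝ)^4 := by
      calc ((2:ℝ)^O.card)^4 = 2^(4*O.card) := by rw [← pow_mul, mul_comm]
        _ ≤ 2^K := pow_le_pow_right₀ (by norm_num) hO4.le
        _ < ((4/3:ℝ)^4)^K := pow_lt_pow_left₀ (by norm_num) (by norm_num) hK.ne'
        _ = ((4/3:ℝ)^K)^4 := by rw [← pow_mul, ← pow_mul, mul_comm]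
        _ ≤ _ := by gcongr
    have := lt_of_pow_lt_pow_left₀ 4 (by positivity) h1
    exact_mod_cast this
  obtain ⟨s, hs, t, ht, hst, heq⟩ := Finset.exists_ne_map_eq_of_card_lt_of_maps_to hlt
    (f := fun s => s ∩ O) (fun s _ => by simp)
  refine ⟨s, hs, t, ht, hst, ?_⟩
  intro l
  unfold fF
  apply Finset.sum_congr rfl
  intro i _
  by_cases h : 1 - ε^2 < ∑ m, u i m * ω l m
  · have hiO : i ∈ O := by
      simp only [O, Finset.mem_biUnion]
      refine ⟨l, ?_, by simpa using h⟩
      simp only [hL, ← hG, Finset.mem_filter, Finset.mem_univ, true_and, Set.mem_compl_iff,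
        mem_closedBall_zero_iff, not_le]
      rw [aux_inner] at h
      have := real_inner_le_norm (u i) (ω l)
      rw [hu i] at this; linarith
    have hiff : i ∈ s ↔ i ∈ t := by
      have := congrArg (fun S => i ∈ S) heq
      simpa [hiO] using this
    simp [sg, hiff]
  · rw [relu, max_eq_right (by linarith), mul_zero, mul_zero]

lemma aux_ae (d n : ℕ) :
    ∀ᵐ ω ∂(Measure.pi (fun _ : Fin n => uniformBall d)), ∀ l, ‖ω l‖ ≤ 1 := by
  rw [ae_all_iff]
  intro l
  have h1 : ∀ᵐ x ∂(uniformBall d), ‖x‖ ≤ 1 := by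
    unfold uniformBall
    apply Measure.ae_smul_measure
    filter_upwards [ae_restrict_mem measurableSet_closedBall] with x hx
    simpa using hx
  have hs : ∀ _ : Fin n, SigmaFinite (uniformBall d) := fun _ => inferInstance
  exact (Measure.tendsto_eval_ae_ae (μ := fun _ : Fin n => uniformBall d) (i := l)).eventually h1

set_option maxHeartbeats 2000000 in
/-- **Indistinguishable packing of boundary ReLU atoms (Construction
`const:ridgelike_RTV_g` + Lemma `lem:indistinguish`).** -/
theorem boundary_relu_packing_indistinguishable
    (d : ℕ) (hd : 2 ≤ d) :
    ∃ κ > (0 : ℝ), ∃ c > (0 : ℝ), ∃ cstar > (0 : ℝ), ∃ n₀ : ℕ,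
      ∀ n ≥ n₀,
      ∃ (M K : ℕ) (ξ : Fin M → Fin K → ℝ) (u : Fin K → Euc d),
        2 ≤ M ∧
        (∀ j i, ξ j i = 1 ∨ ξ j i = -1) ∧
        (∀ i, ‖u i‖ = 1) ∧
        (let ε : ℝ := (cstar / (n : ℝ)) ^ ((1 : ℝ) / ((d : ℝ) + 1))
         let f : Fin M → Euc d → ℝ := fun j z =>
           ∑ i, ξ j i * (ε ^ 2)⁻¹ * relu ((∑ l, u i l * z l) - (1 - ε ^ 2))
         (∀ j, ∀ z ∈ Metric.closedBall (0 : Euc d) 1, |f j z| ≤ 1) ∧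
         (∀ j, VgSeminorm d 1 (gPow d) (f j) ≤ 1) ∧
         (∀ j k, j ≠ k →
            c * (n : ℝ) ^ (-(2 : ℝ) / ((d : ℝ) + 1)) ≤
              ∫ z in Metric.closedBall (0 : Euc d) 1, (f j z - f k z) ^ 2) ∧
         ENNReal.ofReal (1 - Real.exp (-κ * (n : ℝ) ^ (((d : ℝ) - 1) / ((d : ℝ) + 1)))) ≤
           Measure.pi (fun _ : Fin n => uniformBall d)
             {ω | ∃ j k, j ≠ k ∧ ∀ i, f j (ω i) = f k (ω i)}) := by
  obtain ⟨d', rfl⟩ : ∃ d', d = d' + 1 := ⟨d - 1, by omega⟩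
  set D : ℝ := ((d' + 1 : ℕ) : ℝ) with hD
  have hDd : D = d' + 1 := by rw [hD]; push_cast; ring
  have hD1 : 1 ≤ D := by rw [hDd]; have : (0:ℝ) ≤ d' := by positivity
                         linarith
  have hD0 : 0 < D := by linarith
  set A : ℝ := (8 * D)^d' with hA
  have hA1 : 1 ≤ A := one_le_pow₀ (by linarith)
  have hA0 : 0 < A := by linarith
  set cs : ℝ := 1 / (16 * D * A) with hcs
  have hcs0 : 0 < cs := by positivity
  have hcs1 : cs ≤ 1 := by
    rw [hcs, div_le_one (by positivity)]
    nlinarith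
  refine ⟨cs ^ (-((D - 1) / (D + 1))) / (8 * A), by positivity,
    cs ^ (2 / (D + 1)) / (32 * D^d' * A), by positivity, cs, hcs0, (4 * (d'+1))^(d'+2), ?_⟩
  intro n hn
  have hnR : (4 * D)^(d'+2) ≤ (n:ℝ) := by
    rw [hDd]; exact_mod_cast hn
  have hn0 : (0:ℝ) < n := lt_of_lt_of_le (by positivity) hnR
  set ε : ℝ := (cs / (n : ℝ)) ^ ((1 : ℝ) / (D + 1)) with hεdef
  have hε : 0 < ε := by positivity
  have hεk : ∀ k : ℕ, ε ^ k = (cs / n) ^ ((k:ℝ) / (D+1)) := by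
    intro k
    rw [hεdef, ← Real.rpow_natCast, ← Real.rpow_mul (by positivity)]
    congr 1; ring
  have hεtop : ε ^ (d'+2) = cs / n := by
    rw [hεk]
    have : ((d' + 2 : ℕ) : ℝ) / (D+1) = 1 := by
      rw [hDd]; push_cast; rw [div_eq_one_iff_eq (by positivity)]; ring
    rw [this, Real.rpow_one]
  have hε4 : ε ≤ 1 / (4 * D) := by
    apply le_of_pow_le_pow_left₀ (n := d'+2) (by omega) (by positivity)
    rw [hεtop, div_pow, one_pow]
    apply div_le_div₀ (by norm_num) hcs1 (by positivity) hnR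
  have hε4' : 4 * D * ε ≤ 1 := by
    rw [le_div_iff₀ (by positivity)] at hε4; linarith
  have hε1 : ε ≤ 1 := by nlinarith
  have hε21 : ε^2 ≤ 1 := by nlinarith
  set m : ℕ := ⌊1 / (4 * D * ε)⌋₊ with hm
  have hx1 : 1 ≤ 1 / (4 * D * ε) := by rw [le_div_iff₀ (by positivity)]; linarith
  have hmle : (m:ℝ) ≤ 1 / (4 * D * ε) := Nat.floor_le (by positivity)
  have hm1 : 1 ≤ m := by rw [hm, Nat.one_le_floor_iff]; exact hx1
  have hm1' : (1:ℝ) ≤ m := by exact_mod_cast hm1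
  have hmge : 1 / (4 * D * ε) < m + 1 := Nat.lt_floor_add_one _
  rw [le_div_iff₀ (by positivity)] at hmle
  rw [div_lt_iff₀ (by positivity)] at hmge
  have hDε : 0 < D * ε := by positivity
  have hmlow : 1 ≤ 8 * D * (ε * m) := by nlinarith
  have hmε0 : 0 ≤ ε * m := by positivity
  have hmε : 4 * D * (ε * m) ≤ 1 := by linarith
  have hmε1 : ε * m ≤ 1 := by nlinarith
  have hgrid : 9 * (d':ℝ) * ε^2 * (m:ℝ)^2 ≤ 1 := by
    have h1 : (4 * D * (ε * m))^2 ≤ 1 := pow_le_one₀ (by positivity) hmε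
    have h2 : (d':ℝ) ≤ D^2 := by nlinarith
    have h3 := mul_le_mul_of_nonneg_right h2 (sq_nonneg (ε * m))
    nlinarith [mul_nonneg (sq_nonneg D) (sq_nonneg (ε * m))]
  have hpts := aux_pts d' m ε hε hgrid
  obtain ⟨K, hK⟩ : ∃ K : ℕ, K = m^d' := ⟨_, rfl⟩
  rw [← hK] at hpts
  obtain ⟨u, hu, hsep⟩ := hpts
  have hK0 : 0 < K := by rw [hK]; positivity
  have hKr : (K:ℝ) = (m:ℝ)^d' := by rw [hK]; push_cast; rfl
  have hKlow : 1 ≤ A * (ε^d' * K) := by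
    have := one_le_pow₀ (n := d') hmlow
    rw [hKr, ← mul_pow, hA, ← mul_pow]; exact this
  have hKup : ε^d' * K ≤ 1 := by
    rw [hKr, ← mul_pow]; exact pow_le_one₀ hmε0 hmε1
  have hKV : (K:ℝ) * ε ^ (2*(d'+1)+2) ≤ 1 := by
    have : (K:ℝ) * ε ^ (2*(d'+1)+2) = (ε^d' * K) * ε^(d'+4) := by ring
    rw [this]
    exact mul_le_one₀ hKup (by positivity) (pow_le_one₀ hε.le hε1)
  obtain ⟨C, hCd, hCc⟩ := aux_code K hK0
  have hC2 : 2 ≤ C.card := by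
    have h1 : (1:ℝ) < (4/3:ℝ)^K := one_lt_pow₀ (by norm_num) hK0.ne'
    have h2 : (1:ℝ) < C.card := lt_of_lt_of_le h1 hCc
    have : 1 < C.card := by exact_mod_cast h2
    omega
  have hinj : Function.Injective u := by
    intro i j hij
    by_contra h
    have := hsep i j h
    rw [hij] at this
    simp at this
    nlinarith [pow_pos hε 2]
  let e := C.equivFin
  refine ⟨C.card, K, fun j => sg (e.symm j).1, u, hC2, fun j i => sg_pm _ _, hu, ?_⟩
  intro ε' f
  have hf : ∀ j, f j = fF ε u (sg (e.symm j).1) := fun j => rfl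
  refine ⟨?_, ?_, ?_, ?_⟩
  · intro j z hz
    rw [hf]
    exact fF_bound ε hε u hu hsep _ (sg_pm _) z (by simpa using hz)
  · intro j
    exact aux_Vg ε hε hε1 u hu hinj _ (sg_pm _) hKV
  · intro j k hjk
    simp only [hf]
    have hne : (e.symm j).1 ≠ (e.symm k).1 := by
      intro h; exact hjk (e.symm.injective (Subtype.ext h))
    have h8 := hCd _ (e.symm j).2 _ (e.symm k).2 hne
    have h8' : (K:ℝ) ≤ 8 * ((symmDiff (e.symm j).1 (e.symm k).1).card : ℝ) := by exact_mod_cast h8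
    have hL := fF_L2 ε hε u hu hsep (e.symm j).1 (e.symm k).1 ((ε^2/4) * (ε/(d'+1))^d')
      (fun i => icap_vol ε hε hε1 (u i) (hu i))
    refine le_trans ?_ hL
    have hv0 : 0 ≤ (ε^2/4) * (ε/(d'+1))^d' := by positivity
    have h9 := mul_le_mul_of_nonneg_right h8' hv0
    have hε2 : cs ^ (2 / (D + 1)) * (n:ℝ) ^ (-(2:ℝ) / (D + 1)) = ε^2 := by
      rw [hεk, Real.div_rpow hcs0.le hn0.le, neg_div, Real.rpow_neg hn0.le]
      push_cast
      exact (div_eq_mul_inv _ _).symm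
    have h10 : cs ^ (2 / (D + 1)) / (32 * D^d' * A) * (n:ℝ) ^ (-(2:ℝ) / (D + 1))
        = ε^2 / (32 * D^d' * A) := by
      rw [div_mul_eq_mul_div, hε2]
    rw [h10]
    have h11 : (K:ℝ) * ((ε^2/4) * (ε/(d'+1))^d') = 8 * (ε^2 * (ε^d' * K) / (32 * D^d')) := by
      rw [← hDd, div_pow]; field_simp; ring
    have h12 : ε^2 / (32 * D^d' * A) ≤ ε^2 * (ε^d' * K) / (32 * D^d') := by
      rw [div_le_div_iff₀ (by positivity) (by positivity)]
      have := mul_le_mul_of_nonneg_left hKlow (by positivity : 0 ≤ ε^2 * (32 * D^d'))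
      linarith
    linarith
  · set μ := Measure.pi (fun _ : Fin n => uniformBall (d'+1)) with hμ
    set T : Set (Fin n → Euc (d'+1)) := {ω | ∃ j k, j ≠ k ∧ ∀ i, f j (ω i) = f k (ω i)} with hT
    let B : Set (Fin n → Euc (d'+1)) := {ω | (K:ℝ)/4 ≤
      (cnt (Metric.closedBall (0 : Euc (d'+1)) (1 - ε^2))ᶜ ω : ℝ)}
    have hB : μ.real B ≤ Real.exp (2 * n * (D * ε^2) - K/4) :=
      aux_chernoff (uniformBall (d'+1)) n (Metric.closedBall (0 : Euc (d'+1)) (1 - ε^2))ᶜ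
        measurableSet_closedBall.compl (D * ε^2) (K/4) (aux_shell (d'+1) ε hε21)
    have hBK : 2 * n * (D * ε^2) - K/4 ≤ -(K/8 : ℝ) := by
      have h1 : n * ε^2 * ε^d' = cs := by
        rw [mul_assoc, ← pow_add, add_comm 2 d', hεtop]; field_simp
      have h2 : n * ε^2 ≤ A * K * cs := by
        have := mul_le_mul_of_nonneg_left hKlow (by positivity : 0 ≤ n * ε^2)
        rw [← h1]; linarith
      have h3 : D * (A * K * cs) = K / 16 := by
        rw [hcs]; field_simp
      have h4 := mul_le_mul_of_nonneg_left h2 hD0.le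
      linarith
    have hKκ : cs ^ (-((D - 1) / (D + 1))) / (8 * A) * (n:ℝ) ^ ((D - 1) / (D + 1)) ≤ K/8 := by
      have h1 : cs ^ (-((D - 1) / (D + 1))) * (n:ℝ) ^ ((D - 1) / (D + 1)) = (ε^d')⁻¹ := by
        have : D - 1 = (d':ℝ) := by rw [hDd]; ring
        rw [this, hεk, Real.div_rpow hcs0.le hn0.le, Real.rpow_neg hcs0.le, inv_div]
        rw [mul_comm]
        exact (div_eq_mul_inv _ _).symm
      rw [div_mul_eq_mul_div, h1, div_le_div_iff₀ (by positivity) (by positivity),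
        inv_mul_le_iff₀ (by positivity)]
      linarith
    have hae : ∀ᵐ ω ∂μ, ∀ l, ‖ω l‖ ≤ 1 := by
      exact aux_ae (d'+1) n
    have hTc : μ Tᶜ ≤ μ B := by
      apply measure_mono_ae
      filter_upwards [hae] with ω hω hωT
      by_contra hωB
      apply hωT
      have hlt := not_le.1 hωB
      obtain ⟨s, hs, t, ht, hst, heq⟩ := fF_pigeon ε u hu hsep C hCc hK0 ω hω hlt
      refine ⟨e ⟨s, hs⟩, e ⟨t, ht⟩, ?_, ?_⟩
      · intro h
        exact hst (congrArg Subtype.val (e.injective h))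
      · intro i
        simp only [hf, Equiv.symm_apply_apply]
        exact heq i
    have hBE : μ B ≤ ENNReal.ofReal (Real.exp (-(cs ^ (-((D - 1) / (D + 1))) / (8 * A)) * (n:ℝ) ^ ((D - 1) / (D + 1)))) := by
      rw [← ENNReal.ofReal_toReal (measure_ne_top μ B)]
      apply ENNReal.ofReal_le_ofReal
      refine hB.trans (Real.exp_le_exp.2 ?_)
      linarith
    rw [ENNReal.ofReal_sub _ (Real.exp_pos _).le, ENNReal.ofReal_one, tsub_le_iff_right]
    calc (1:ℝ≥0∞) = μ Set.univ := by simp [hμ]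
      _ ≤ μ T + μ Tᶜ := by rw [← Set.union_compl_self T]; exact measure_union_le _ _
      _ ≤ _ := by gcongr; exact hTc.trans hBE

end
end
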